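/- arXiv:2407.15769 — 3 statements merged into one kernel-verified Lean document; each statement's English description precedes it below -/
import Mathlib

section
/- Let K be a field and α ∈ K with α ≠ 0. For all scalars λ₀,λ₁,λ₂,λ₃ ∈ K, every commutative associative (not necessarily unital) K-algebra B equipped with an involutive K-linear ring involution *, and all elements u,v ∈ B satisfying p(u,u) = u, p(v,v) = αu + v, p(u,v) = 0 and p(v,u) = 0, the elements u and v are K-linearly dependent. (Equivalently: the evolution algebra A_{3,α}, with natural basis e₁,e₂, e₁e₂ = 0, e₁² = e₁, e₂² = αe₁ + e₂, has no faithful associative and commutative representation.) -/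
section CommRing

variable {R : Type*} [CommRing R] {p l m q α a b c d : R}

/-- In the self-adjoint case `u = u*`, products with `v` and `v*` vanishing force `u = 0`. -/
theorem eq_zero_of_selfAdjoint (hα : IsUnit α)
    (h1 : p * (a * a) + l * (a * a) + m * (a * a) + q * (a * a) = a)
    (h2 : p * (c * c) + l * (c * d) + m * (d * c) + q * (d * d) = α * a + c)
    (hc : a * c = 0) (hd : a * d = 0) : a = 0 := by
  have h : α * (a * a) = 0 := by
    linear_combination (-a) * h2 + (p * c + l * d + m * d - 1) * hc + q * d * hd
  have ha : a * a = 0 := hα.mul_right_eq_zero.mp h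
  linear_combination (p + l + m + q) * ha - h1

/-- If `u = u*` and `u v = u* v*`, then `u = 0`. -/
theorem eq_zero_of_selfAdjoint_of_mul_eq (hα : IsUnit α)
    (h1 : p * (a * a) + l * (a * a) + m * (a * a) + q * (a * a) = a)
    (h2 : p * (c * c) + l * (c * d) + m * (d * c) + q * (d * d) = α * a + c)
    (h3 : p * (a * c) + l * (a * d) + m * (a * c) + q * (a * d) = 0)
    (hcd : a * c = a * d) : a = 0 := by
  have hc : a * c = 0 := by
    linear_combination a * h3 - c * h1 + (l + q) * a * hcd
  exact eq_zero_of_selfAdjoint hα h1 h2 hc (hcd ▸ hc)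

/-- If `u v = u* v*` and `u v* = u* v`, then `u` is self-adjoint. -/
theorem eq_star_of_nonsymm (hα : IsUnit α)
    (h1 : (p - q) * (a * a - b * b) = a - b)
    (h2 : (p - q) * (c * c - d * d) = α * (a - b) + (c - d))
    (hP : a * c = b * d) (hX : a * d = b * c) : a = b := by
  have h : α * (a * a - b * b) = 0 := by
    linear_combination (-(a + b)) * h2 + ((p - q) * (c + d) - 1) * hP
      + ((p - q) * (-c - d) + 1) * hX
  have h' := hα.mul_right_eq_zero.mp h
  linear_combination (p - q) * h' - h1

/-- If the product is symmetric and `u v = u* v*`, then `u` is self-adjoint. -/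
theorem eq_star_of_symm (hα : IsUnit α)
    (h1 : p * (a * a) + l * (a * b) + l * (b * a) + q * (b * b) = a)
    (h1' : p * (b * b) + l * (b * a) + l * (a * b) + q * (a * a) = b)
    (h2 : p * (c * c) + l * (c * d) + l * (d * c) + q * (d * d) = α * a + c)
    (h2' : p * (d * d) + l * (d * c) + l * (c * d) + q * (c * c) = α * b + d)
    (h3 : p * (a * c) + l * (a * d) + l * (b * c) + q * (b * d) = 0)
    (hP : a * c = b * d) : a = b := by
  obtain ⟨f, rfl⟩ : ∃ f, a = b + f := ⟨a - b, by ring⟩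
  obtain ⟨k, rfl⟩ : ∃ k, c = d + k := ⟨c - d, by ring⟩
  have hf : (p - q) * (2 * b + f) * f = f := by linear_combination h1 - h1'
  have hk : (p - q) * (2 * d + k) * k = α * f + k := by linear_combination h2 - h2'
  have hfc : f * (d + k) + b * k = 0 := by linear_combination hP
  have hfd : f * d + (b + f) * k = 0 := by linear_combination hP
  have hff : f * f = 0 := by
    have hA : b * k ^ 2 + b * k * f = α * (b + f) * f ^ 2 := by
      linear_combination f ^ 2 * h2 - k ^ 2 * h1' + f * hfc
        - p * (f * (d + k) - b * k) * hfc - 2 * l * (f * d * hfc - b * k * hfd)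
        - q * (f * d - (b + f) * k) * hfd
    have hB : b * k ^ 2 + b * k * f = -(α * b * f ^ 2) := by
      linear_combination -b * f * hk + (p - q) * b * k * (hfc + hfd)
        - k * ((p - q) * (2 * b + f) - 1) * hfc + k * (d + k) * hf
    refine hα.mul_right_eq_zero.mp ?_
    linear_combination -(p - q) * (hA - hB) - α * f * hf
  have hfb : 2 * (p - q) * f * b = f := by linear_combination hf - (p - q) * hff
  have hfk : f * k = 0 := by
    linear_combination (-k) * hfb + 2 * (p - q) * f * hfc - 2 * (p - q) * (d + k) * hff
  have hfbb : (p + 2 * l + q) * (f * b * b) = f * b := by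
    linear_combination f * h1' - (2 * l * b + q * (2 * b + f)) * hff
  have hn : (p + 2 * l + q) * (f * b) = f := by
    linear_combination 2 * (p - q) * hfbb + (1 - (p + 2 * l + q) * b) * hfb
  have hfd' : f * d = 0 := by
    linear_combination f * h3 - d * hn - (p * b + l * b) * hfk
      - (p * (d + k) + l * d) * hff
  have hαf : α * f = 0 := by
    linear_combination -α * hf - (p - q) * (2 * b + f) * hk
      + (p - q) * ((p - q) * (2 * d + k) - 1) * (hfc + hfd)
      - (p - q) * ((p - q) * (2 * d + k) - 1) * (2 * hfd' + hfk)
  rw [hα.mul_right_eq_zero.mp hαf, add_zero]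

/-- If the scalars are such that each difference `λ₁ - λ₂`, `λ₀ - λ₃` is zero or invertible, then
the relations defining a representation of `A_{3,α}` force `u = 0`. -/
theorem eq_zero_of_relations (hα : IsUnit α)
    (hpq : p = q ∨ IsUnit (p - q)) (hlm : l = m ∨ IsUnit (l - m))
    (h1 : p * (a * a) + l * (a * b) + m * (b * a) + q * (b * b) = a)
    (h1' : p * (b * b) + l * (b * a) + m * (a * b) + q * (a * a) = b)
    (h2 : p * (c * c) + l * (c * d) + m * (d * c) + q * (d * d) = α * a + c)
    (h2' : p * (d * d) + l * (d * c) + m * (c * d) + q * (c * c) = α * b + d)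
    (h3 : p * (a * c) + l * (a * d) + m * (b * c) + q * (b * d) = 0)
    (h3' : p * (b * d) + l * (b * c) + m * (a * d) + q * (a * c) = 0)
    (h4 : p * (c * a) + l * (c * b) + m * (d * a) + q * (d * b) = 0) : a = 0 := by
  rcases hpq with rfl | hδ
  · have hab : a = b := by linear_combination h1' - h1
    subst hab
    have hcd : c = d := by linear_combination h2' - h2
    subst hcd
    exact eq_zero_of_selfAdjoint_of_mul_eq hα h1 h2 h3 rfl
  have hP : a * c = b * d := by
    refine sub_eq_zero.mp (hδ.mul_right_eq_zero.mp ?_)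
    linear_combination h4 - h3'
  have hab : a = b := by
    rcases hlm with rfl | hε
    · exact eq_star_of_symm hα h1 h1' h2 h2' h3 hP
    · refine eq_star_of_nonsymm (p := p) (q := q) hα ?_ ?_ hP ?_
      · linear_combination h1 - h1'
      · linear_combination h2 - h2'
      · refine sub_eq_zero.mp (hε.mul_right_eq_zero.mp ?_)
        linear_combination h3 - h4
  subst hab
  exact eq_zero_of_selfAdjoint_of_mul_eq hα h1 h2 h3 hP

end CommRing


/-- The evolution algebra `A_{3,α}` (`e₁² = e₁`, `e₂² = αe₁ + e₂`,
`e₁e₂ = 0`, `α ≠ 0`) has no faithful associative and commutative representation: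
for all scalars `λ₀,λ₁,λ₂,λ₃`, every commutative associative (not necessarily unital)
`K`-algebra `B` with a `K`-linear involution `s`, and all `u, v ∈ B` satisfying
`p(u,u) = u`, `p(v,v) = αu + v`, `p(u,v) = 0`, `p(v,u) = 0`
(where `p(u,v) = λ₀uv + λ₁u·v* + λ₂u*·v + λ₃u*·v*`), the elements `u` and `v` are
`K`-linearly dependent. -/
theorem stmt4 (K : Type*) [Field K] (α : K) (hα : α ≠ 0)
    (l0 l1 l2 l3 : K)
    (B : Type*) [NonUnitalCommRing B] [Module K B]
    [SMulCommClass K B B] [IsScalarTower K B B]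
    (s : B →ₗ[K] B)
    (hsmul : ∀ x y : B, s (x * y) = s x * s y)
    (hsinv : ∀ x : B, s (s x) = x)
    (u v : B)
    (huu : l0 • (u * u) + l1 • (u * s u) + l2 • (s u * u) + l3 • (s u * s u) = u)
    (hvv : l0 • (v * v) + l1 • (v * s v) + l2 • (s v * v) + l3 • (s v * s v) = α • u + v)
    (huv : l0 • (u * v) + l1 • (u * s v) + l2 • (s u * v) + l3 • (s u * s v) = 0)
    (hvu : l0 • (v * u) + l1 • (v * s u) + l2 • (s v * u) + l3 • (s v * s u) = 0) :
    ¬ LinearIndependent K ![u, v] := by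
  intro hli
  have hunit : ∀ x y : K, x = y ∨
      IsUnit (algebraMap K (Unitization K B) x - algebraMap K (Unitization K B) y) := by
    intro x y
    refine (eq_or_ne x y).imp_right fun h => ?_
    rw [← map_sub]
    exact (sub_ne_zero.mpr h).isUnit.map _
  have lift : ∀ x y z : B,
      l0 • (x * y) + l1 • (x * s y) + l2 • (s x * y) + l3 • (s x * s y) = z →
      algebraMap K (Unitization K B) l0 * ((x : Unitization K B) * y) +
        algebraMap K (Unitization K B) l1 * ((x : Unitization K B) * (s y : B)) +
        algebraMap K (Unitization K B) l2 * (((s x : B) : Unitization K B) * y) +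
        algebraMap K (Unitization K B) l3 * (((s x : B) : Unitization K B) * (s y : B)) = z := by
    rintro x y z rfl
    simp only [← Algebra.smul_def, Unitization.inr_add, Unitization.inr_smul, Unitization.inr_mul]
  have star : ∀ x y z : B,
      l0 • (x * y) + l1 • (x * s y) + l2 • (s x * y) + l3 • (s x * s y) = z →
      l0 • (s x * s y) + l1 • (s x * s (s y)) + l2 • (s (s x) * s y) +
        l3 • (s (s x) * s (s y)) = s z := by
    rintro x y z rfl
    simp only [map_add, map_smul, hsmul]
  have hcoe : ∀ x y : B, ((α • x + y : B) : Unitization K B) =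
      algebraMap K (Unitization K B) α * x + y := by
    intro x y
    rw [← Algebra.smul_def, Unitization.inr_add, Unitization.inr_smul]
  have h1' := lift _ _ _ (star _ _ _ huu)
  have h2' := lift _ _ _ (star _ _ _ hvv)
  have h3' := lift _ _ _ (star _ _ _ huv)
  simp only [hsinv, map_add, map_smul, hcoe, map_zero, Unitization.inr_zero] at h1' h2' h3'
  have hu : (u : Unitization K B) = 0 :=
    eq_zero_of_relations (hα.isUnit.map (algebraMap K (Unitization K B)))
      ((hunit l0 l3).imp_left fun h => by rw [h]) ((hunit l1 l2).imp_left fun h => by rw [h])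
      (lift _ _ _ huu) h1' ((lift _ _ _ hvv).trans (hcoe u v)) h2'
      ((lift _ _ _ huv).trans (Unitization.inr_zero K)) h3'
      ((lift _ _ _ hvu).trans (Unitization.inr_zero K))
  exact hli.ne_zero 0 (Unitization.inr_injective (hu.trans (Unitization.inr_zero K).symm))
end

section
/- Let K be an algebraically closed field and let H be a commutative Hopf algebra over K that is finitely generated as a K-algebra. Then there is exactly one K-algebra homomorphism H → K if and only if either H is isomorphic to K as a K-algebra, or K has prime characteristic p and H is isomorphic as a K-algebra to K[x₁,…,xₙ]/(x₁^{p^{e₁}},…,xₙ^{p^{eₙ}}) for some n ≥ 1 and positive integers e₁,…,eₙ. -/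
open scoped TensorProduct

/-- A commutative algebra with an augmentation and a comultiplication that is an algebra
homomorphism satisfying both counit laws; coassociativity and an antipode are not required. -/
structure CounitalComul (K A : Type*) [Field K] [CommRing A] [Algebra K A] where
  counit : A →ₐ[K] K
  comul : A →ₐ[K] A ⊗[K] A
  rTensor_counit (a : A) : counit.toLinearMap.rTensor A (comul a) = 1 ⊗ₜ a
  lTensor_counit (a : A) : counit.toLinearMap.lTensor A (comul a) = a ⊗ₜ 1

/-- The subspace annihilated by all point derivations at `ε`. -/
def pointConstants {K A : Type*} [Field K] [CommRing A] [Algebra K A] (ε : A →ₐ[K] K) :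
    Submodule K A :=
  Submodule.span K {1} ⊔ ((RingHom.ker ε) ^ 2).restrictScalars K

section PointDerivations

variable {K A : Type*} [Field K] [CommRing A] [Algebra K A]

theorem mkQ_pointConstants_mul (ε : A →ₐ[K] K) (a b : A) :
    (pointConstants ε).mkQ (a * b) =
      ε a • (pointConstants ε).mkQ b + ε b • (pointConstants ε).mkQ a := by
  rw [← map_smul, ← map_smul, ← map_add, ← sub_eq_zero, ← map_sub, Submodule.mkQ_apply,
    Submodule.Quotient.mk_eq_zero]
  have h1 : (a - algebraMap K A (ε a)) * (b - algebraMap K A (ε b)) ∈ RingHom.ker ε ^ 2 := by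
    rw [pow_two]
    exact Ideal.mul_mem_mul (by simp [RingHom.mem_ker]) (by simp [RingHom.mem_ker])
  refine Submodule.mem_sup.2 ⟨(-(ε a * ε b)) • 1,
    Submodule.smul_mem _ _ (Submodule.mem_span_singleton_self _), _, h1, ?_⟩
  simp only [Algebra.smul_def, map_neg, map_mul]
  ring

theorem mkQ_pointConstants_algebraMap (ε : A →ₐ[K] K) (c : K) :
    (pointConstants ε).mkQ (algebraMap K A c) = 0 := by
  rw [Submodule.mkQ_apply, Submodule.Quotient.mk_eq_zero, Algebra.algebraMap_eq_smul_one]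
  exact Submodule.mem_sup_left (Submodule.smul_mem _ _ (Submodule.mem_span_singleton_self _))

theorem CounitalComul.exists_derivation (S : CounitalComul K A)
    (φ : A ⧸ pointConstants S.counit →ₗ[K] K) :
    ∃ D : Derivation K A A, ∀ a, S.counit (D a) = φ ((pointConstants S.counit).mkQ a) := by
  set ψ : A →ₗ[K] K := φ ∘ₗ (pointConstants S.counit).mkQ with hψ
  let T : A ⊗[K] A →ₗ[K] A := (TensorProduct.rid K A).toLinearMap ∘ₗ ψ.lTensor A
  let E : A ⊗[K] A →ₗ[K] A :=
    (TensorProduct.rid K A).toLinearMap ∘ₗ S.counit.toLinearMap.lTensor A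
  have hψm (a b : A) : ψ (a * b) = S.counit a * ψ b + S.counit b * ψ a := by
    simp only [hψ, LinearMap.comp_apply, mkQ_pointConstants_mul, map_add, map_smul, smul_eq_mul]
  have hT (s t : A ⊗[K] A) : T (s * t) = E s * T t + E t * T s := by
    induction s with
    | zero => simp
    | add s s' hs hs' => simp only [add_mul, map_add, hs, hs', mul_add]; ring
    | tmul a b =>
      induction t with
      | zero => simp
      | add s s' hs hs' => simp only [add_mul, map_add, hs, hs', mul_add]; ring
      | tmul c d =>
        simp only [T, E, LinearMap.comp_apply, Algebra.TensorProduct.tmul_mul_tmul,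
          LinearMap.lTensor_tmul, LinearEquiv.coe_coe, TensorProduct.rid_tmul, hψm,
          AlgHom.toLinearMap_apply, Algebra.smul_def, map_add, map_mul]
        ring
  have hE (a : A) : E (S.comul a) = a := by simp [E, S.lTensor_counit]
  have hεT (t : A ⊗[K] A) : S.counit (T t) =
      ψ (TensorProduct.lid K A (S.counit.toLinearMap.rTensor A t)) := by
    induction t with
    | zero => simp
    | add s s' hs hs' => simp only [map_add, hs, hs']
    | tmul a b => simp [T, mul_comm]
  refine ⟨Derivation.mk' (T ∘ₗ S.comul.toLinearMap) fun a b => ?_, fun a => ?_⟩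
  · simp [hT, hE]
  · change S.counit (T (S.comul a)) = _
    rw [hεT, S.rTensor_counit, TensorProduct.lid_tmul, one_smul, hψ, LinearMap.comp_apply]

end PointDerivations

theorem exists_dual_derivations {K A ι : Type*} [Field K] [CommRing A] [Algebra K A]
    [Fintype ι] [DecidableEq ι] (S : CounitalComul K A) (hnil : ∀ a, S.counit a = 0 → IsNilpotent a) (w : ι → A)
    (hw : LinearIndependent K ((pointConstants S.counit).mkQ ∘ w)) :
    ∃ D : ι → Derivation K A A, ∀ i j, D i (w j) = if i = j then 1 else 0 := by
  have hex (i : ι) : ∃ D : Derivation K A A, ∀ j, S.counit (D (w j)) = if i = j then 1 else 0 := by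
    obtain ⟨g, hg⟩ := LinearMap.exists_leftInverse_of_injective _
      (LinearMap.ker_eq_bot.2 hw)
    obtain ⟨D, hD⟩ := S.exists_derivation (Finsupp.lapply i ∘ₗ g)
    refine ⟨D, fun j => (hD _).trans ?_⟩
    have := LinearMap.congr_fun hg (Finsupp.single j 1)
    simp only [LinearMap.comp_apply, Finsupp.linearCombination_single, one_smul,
      Function.comp_apply] at this
    simp [-Submodule.mkQ_apply, this, Finsupp.single_apply, eq_comm]
  choose D hD using hex
  let M : Matrix ι ι A := Matrix.of fun i j => D i (w j)
  have hM : IsUnit M.det := by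
    have h : S.counit M.det = 1 := by
      rw [AlgHom.map_det]
      have : S.counit.mapMatrix M = 1 := by
        ext i j
        simp [M, hD, Matrix.one_apply]
      rw [this, Matrix.det_one]
    have := (hnil (M.det - 1) (by simp [h])).isUnit_one_add
    simpa using this
  refine ⟨fun i => ∑ k, M⁻¹ i k • D k, fun i j => ?_⟩
  have := congrFun (congrFun (Matrix.nonsing_inv_mul M hM) i) j
  rw [Matrix.mul_apply, Matrix.one_apply] at this
  rw [← this]
  change Derivation.coeFnAddMonoidHom (∑ k, M⁻¹ i k • D k) (w j) = _
  rw [map_sum, Finset.sum_apply]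
  rfl

theorem MvPolynomial.eq_zero_of_aeval_eq_zero_of_derivation {R A σ : Type*} [CommRing R]
    [CommRing A] [Algebra R A] [DecidableEq σ] (hinj : Function.Injective (algebraMap R A)) {p : ℕ}
    (hp : ∀ k : ℕ, 0 < k → k < p → IsUnit (k : R)) (w : σ → A) (D : σ → Derivation R A A)
    (hD : ∀ i j, D i (w j) = if i = j then 1 else 0) (P : MvPolynomial σ R)
    (hdeg : ∀ m i, p ≤ m i → P.coeff m = 0) (hP : aeval w P = 0) : P = 0 := by
  have hDP (i : σ) (P : MvPolynomial σ R) : D i (aeval w P) = aeval w (pderiv i P) := by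
    induction P using MvPolynomial.induction_on with
    | C a => simp
    | add P Q hP hQ => simp [hP, hQ]
    | mul_X P j hP =>
      simp only [map_mul, aeval_X, Derivation.leibniz, hP, hD, pderiv_X, map_add, smul_eq_mul,
        Pi.single_apply, eq_comm (a := i)]
      split_ifs <;> simp
  have hconst (P : MvPolynomial σ R) (h : ∀ m ≠ 0, P.coeff m = 0) (hP : aeval w P = 0) :
      P = 0 := by
    have hC : P = C (P.coeff 0) := by
      ext m
      rw [coeff_C]
      split_ifs with h0
      · rw [h0]
      · exact h m (Ne.symm h0)
    rw [hC, aeval_C, map_eq_zero_iff _ hinj] at hP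
    rw [hC, hP, C_0]
  have main (n : ℕ) : ∀ P : MvPolynomial σ R, (∀ m : σ →₀ ℕ, n < m.degree → P.coeff m = 0) →
      (∀ m i, p ≤ m i → P.coeff m = 0) → aeval w P = 0 → P = 0 := by
    induction n with
    | zero =>
      intro P hn _ hP
      exact hconst P (fun m hm => hn m
        (Nat.pos_of_ne_zero fun h0 => hm ((Finsupp.degree_eq_zero_iff m).1 h0))) hP
    | succ n ih =>
      intro P hn hdeg hP
      have hd (i : σ) : pderiv i P = 0 := by
        refine ih _ (fun m hm => ?_) (fun m j hm => ?_) ?_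
        · rw [coeff_pderiv, hn _ (by simpa using hm), zero_mul]
        · rw [coeff_pderiv, hdeg _ j (by simp; omega), zero_mul]
        · rw [← hDP, hP, map_zero]
      refine hconst P (fun m hm0 => ?_) hP
      obtain ⟨i, hi⟩ := Finsupp.ne_iff.1 hm0
      by_cases hpi : p ≤ m i
      · exact hdeg m i hpi
      have hle : Finsupp.single i 1 ≤ m := by
        simpa [Nat.one_le_iff_ne_zero] using hi
      have hc := coeff_pderiv (i := i) P (m - Finsupp.single i 1)
      rw [hd, coeff_zero, tsub_add_cancel_of_le hle] at hc
      have hu := hp (m i) (Nat.pos_of_ne_zero hi) (not_le.1 hpi)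
      refine (hu.mul_left_eq_zero).1 ?_
      rw [hc]
      congr 1
      have : 1 ≤ m i := Nat.one_le_iff_ne_zero.2 hi
      simp [Nat.cast_sub this]
  refine main P.totalDegree P (fun m hm => ?_) hdeg hP
  exact coeff_eq_zero_of_totalDegree_lt (by simpa [Finsupp.degree_apply] using hm)

theorem card_pow_mul_finrank_le {K A ι : Type*} [Field K] [CommRing A] [Algebra K A]
    [Module.Finite K A] [Fintype ι] [DecidableEq ι] (B : Subalgebra K A) {p : ℕ}
    (hp : ∀ k : ℕ, 0 < k → k < p → (k : K) ≠ 0) (w : ι → A) (D : ι → Derivation K A A)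
    (hD : ∀ i j, D i (w j) = if i = j then 1 else 0) (hDB : ∀ i, ∀ b ∈ B, D i b = 0) :
    p ^ Fintype.card ι * Module.finrank K B ≤ Module.finrank K A := by
  let D' (i : ι) : Derivation B A A := Derivation.mk'
    { toFun := D i
      map_add' := map_add (D i)
      map_smul' := fun b a => by
        change D i ((b : A) * a) = (b : A) * D i a
        rw [(D i).leibniz, hDB i _ b.2, smul_zero, add_zero, smul_eq_mul] }
    fun a b => (D i).leibniz a b
  let expo (f : ι → Fin p) : ι →₀ ℕ := Finsupp.equivFunOnFinite.symm fun i => (f i : ℕ)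
  have hexpo : Function.Injective expo := fun f g h =>
    funext fun i => Fin.ext (by simpa [expo] using DFunLike.congr_fun h i)
  let Φ : ((ι → Fin p) → B) →ₗ[K] MvPolynomial ι B :=
    { toFun := fun v => ∑ f, MvPolynomial.monomial (expo f) (v f)
      map_add' := fun u v => by simp [Finset.sum_add_distrib]
      map_smul' := fun c v => by
        simp only [Pi.smul_apply, ← MvPolynomial.smul_monomial, Finset.smul_sum,
          RingHom.id_apply] }
  have hcoeff (v : (ι → Fin p) → B) (f) : (Φ v).coeff (expo f) = v f := by
    change MvPolynomial.coeff _ (∑ f, MvPolynomial.monomial (expo f) (v f)) = _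
    simp [MvPolynomial.coeff_sum, MvPolynomial.coeff_monomial, hexpo.eq_iff]
  have hcoeff0 (v : (ι → Fin p) → B) (m : ι →₀ ℕ) (i : ι) (hm : p ≤ m i) :
      (Φ v).coeff m = 0 := by
    change MvPolynomial.coeff _ (∑ f, MvPolynomial.monomial (expo f) (v f)) = _
    simp only [MvPolynomial.coeff_sum, MvPolynomial.coeff_monomial]
    refine Finset.sum_eq_zero fun f _ => if_neg ?_
    rintro rfl
    exact absurd (f i).2 (not_lt.2 hm)
  have hinj : Function.Injective
      (((MvPolynomial.aeval w : MvPolynomial ι B →ₐ[B] A).toLinearMap.restrictScalars K) ∘ₗ Φ) := by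
    rw [← LinearMap.ker_eq_bot, LinearMap.ker_eq_bot']
    intro v hv
    have h0 := MvPolynomial.eq_zero_of_aeval_eq_zero_of_derivation (R := B)
      Subtype.val_injective
      (fun k h0 hk => by
        have := (hp k h0 hk).isUnit.map (algebraMap K B)
        simpa using this) w D' hD (Φ v) (hcoeff0 v) hv
    funext f
    rw [← hcoeff v f, h0, MvPolynomial.coeff_zero, Pi.zero_apply]
  have := LinearMap.finrank_le_finrank_of_injective hinj
  simpa [Module.finrank_pi_fintype] using this

theorem adjoin_eq_top_of_span_mkQ_eq_top {K A ι : Type*} [Field K] [CommRing A] [Algebra K A]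
    (ε : A →ₐ[K] K) (hnil : IsNilpotent (RingHom.ker ε)) (w : ι → A) (hεw : ∀ i, ε (w i) = 0)
    (hw : Submodule.span K (Set.range ((pointConstants ε).mkQ ∘ w)) = ⊤) :
    Algebra.adjoin K (Set.range w) = ⊤ := by
  set m := RingHom.ker ε with hm
  set S := Algebra.adjoin K (Set.range w) with hS
  have h1 (a : A) (ha : a ∈ m) : ∃ s ∈ S, s ∈ m ∧ a - s ∈ m ^ 2 := by
    have ha' : (pointConstants ε).mkQ a ∈
        Submodule.span K (Set.range ((pointConstants ε).mkQ ∘ w)) := hw ▸ Submodule.mem_top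
    rw [Set.range_comp, Submodule.span_image] at ha'
    obtain ⟨s, hs, hsa⟩ := ha'
    have hsS : s ∈ S := Algebra.span_le_adjoin K _ hs
    have hsm : s ∈ m := by
      have : Submodule.span K (Set.range w) ≤ m.restrictScalars K :=
        Submodule.span_le.2 (by rintro _ ⟨i, rfl⟩; exact hεw i)
      exact this hs
    refine ⟨s, hsS, hsm, ?_⟩
    rw [eq_comm, ← sub_eq_zero, ← map_sub, Submodule.mkQ_apply,
      Submodule.Quotient.mk_eq_zero] at hsa
    obtain ⟨c', hc', u, hu, hcu⟩ := Submodule.mem_sup.1 hsa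
    obtain ⟨c, rfl⟩ := Submodule.mem_span_singleton.1 hc'
    have hu' : u ∈ m ^ 2 := hu
    have hum : ε u = 0 := Ideal.pow_le_self two_ne_zero hu'
    have := congrArg ε hcu
    rw [map_add, map_smul, map_one, hum, map_sub, show ε a = 0 from ha,
      show ε s = 0 from hsm] at this
    have hc : c = 0 := by simpa using this
    rw [← hcu, hc, zero_smul, zero_add]
    exact hu'
  have h2 (k : ℕ) : ∀ b ∈ m ^ k, ∃ t ∈ S, t ∈ m ^ k ∧ b - t ∈ m ^ (k + 1) := by
    induction k with
    | zero =>
      intro b _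
      refine ⟨algebraMap K A (ε b), S.algebraMap_mem _, by simp, ?_⟩
      simp [hm, RingHom.mem_ker]
    | succ k ih =>
      intro b hb
      rw [pow_succ'] at hb
      induction hb using Submodule.mul_induction_on' with
      | mem_mul_mem a ha b hb =>
        obtain ⟨s, hs, hsm, has⟩ := h1 a ha
        obtain ⟨t, ht, htm, hbt⟩ := ih b hb
        refine ⟨s * t, S.mul_mem hs ht, by rw [pow_succ']; exact Ideal.mul_mem_mul hsm htm, ?_⟩
        have e : a * b - s * t = a * (b - t) + (a - s) * t := by ring
        rw [e]
        refine Ideal.add_mem _ ?_ ?_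
        · rw [pow_succ']
          exact Ideal.mul_mem_mul ha hbt
        · rw [show k + 1 + 1 = 2 + k by ring, pow_add]
          exact Ideal.mul_mem_mul has htm
      | add b _ c _ hb hc =>
        obtain ⟨s, hs, hsm, has⟩ := hb
        obtain ⟨t, ht, htm, hbt⟩ := hc
        refine ⟨s + t, S.add_mem hs ht, Ideal.add_mem _ hsm htm, ?_⟩
        rw [add_sub_add_comm]
        exact Ideal.add_mem _ has hbt
  have h3 (k : ℕ) (a : A) : ∃ s ∈ S, a - s ∈ m ^ k := by
    induction k with
    | zero => exact ⟨0, S.zero_mem, by simp⟩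
    | succ k ih =>
      obtain ⟨s, hs, has⟩ := ih
      obtain ⟨t, ht, -, h⟩ := h2 k _ has
      exact ⟨s + t, S.add_mem hs ht, by rwa [← sub_sub]⟩
  obtain ⟨k, hk⟩ := hnil
  refine eq_top_iff.2 fun a _ => ?_
  obtain ⟨s, hs, has⟩ := h3 k a
  rw [hk, Ideal.zero_eq_bot, Ideal.mem_bot, sub_eq_zero] at has
  exact has ▸ hs

theorem finrank_quotient_span_X_pow_le {K ι : Type*} [Field K] [Fintype ι] (d : ι → ℕ) :
    Module.Finite K (MvPolynomial ι K ⧸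
      Ideal.span (Set.range fun i => (MvPolynomial.X i : MvPolynomial ι K) ^ d i)) ∧
    Module.finrank K (MvPolynomial ι K ⧸
      Ideal.span (Set.range fun i => (MvPolynomial.X i : MvPolynomial ι K) ^ d i)) ≤ ∏ i, d i := by
  classical
  set I := Ideal.span (Set.range fun i => (MvPolynomial.X i : MvPolynomial ι K) ^ d i) with hI
  let v : (∀ i, Fin (d i)) → MvPolynomial ι K ⧸ I := fun f =>
    Ideal.Quotient.mk I (MvPolynomial.monomial (Finsupp.equivFunOnFinite.symm fun i => (f i : ℕ)) 1)
  have hv : Submodule.span K (Set.range v) = ⊤ := by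
    refine eq_top_iff.2 fun q _ => ?_
    obtain ⟨P, rfl⟩ := Ideal.Quotient.mk_surjective q
    induction P using MvPolynomial.induction_on' with
    | add P Q hP hQ => rw [map_add]; exact Submodule.add_mem _ (hP trivial) (hQ trivial)
    | monomial m c =>
      by_cases hm : ∀ i, m i < d i
      · have : (Ideal.Quotient.mk I (MvPolynomial.monomial m c)) = c • v fun i => ⟨m i, hm i⟩ := by
          have : MvPolynomial.monomial m c = c • MvPolynomial.monomial m (1 : K) := by
            rw [MvPolynomial.smul_monomial, smul_eq_mul, mul_one]
          rw [this, ← Ideal.Quotient.mkₐ_eq_mk K, map_smul]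
          have hm' : m = Finsupp.equivFunOnFinite.symm fun i => m i := by ext i; simp
          exact congrArg
            (fun t => c • Ideal.Quotient.mkₐ K I (MvPolynomial.monomial t (1 : K))) hm'
        rw [this]
        exact Submodule.smul_mem _ _ (Submodule.subset_span ⟨_, rfl⟩)
      · push Not at hm
        obtain ⟨i, hi⟩ := hm
        have : MvPolynomial.monomial m c ∈ I := by
          have hle : Finsupp.single i (d i) ≤ m := by simpa using hi
          rw [← add_tsub_cancel_of_le hle, ← one_mul c, ← MvPolynomial.monomial_mul,
            ← MvPolynomial.X_pow_eq_monomial]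
          exact I.mul_mem_right _ (Ideal.subset_span ⟨i, rfl⟩)
        rw [Ideal.Quotient.eq_zero_iff_mem.2 this]
        exact Submodule.zero_mem _
  constructor
  · exact Module.Finite.of_fg_top ⟨(Set.finite_range v).toFinset, by simpa using hv⟩
  · have := finrank_range_le_card (R := K) v
    rw [Set.finrank, hv, finrank_top] at this
    simpa using this

theorem nonempty_algEquiv_quotient_span_X_pow {K A ι : Type*} [Field K] [CommRing A] [Algebra K A]
    [Module.Finite K A] [Fintype ι] (x : ι → A) (d : ι → ℕ) (hx : ∀ i, x i ^ d i = 0)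
    (hgen : Algebra.adjoin K (Set.range x) = ⊤) (hrank : ∏ i, d i ≤ Module.finrank K A) :
    Nonempty (A ≃ₐ[K] (MvPolynomial ι K ⧸
      Ideal.span (Set.range fun i => (MvPolynomial.X i : MvPolynomial ι K) ^ d i))) := by
  set I := Ideal.span (Set.range fun i => (MvPolynomial.X i : MvPolynomial ι K) ^ d i) with hI
  obtain ⟨hfin, hle⟩ := finrank_quotient_span_X_pow_le (K := K) d
  have hker : ∀ P ∈ I, MvPolynomial.aeval x P = 0 := by
    have : I ≤ RingHom.ker (MvPolynomial.aeval x : MvPolynomial ι K →ₐ[K] A) := by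
      refine Ideal.span_le.2 ?_
      rintro _ ⟨i, rfl⟩
      simp [RingHom.mem_ker, hx]
    exact this
  let g : (MvPolynomial ι K ⧸ I) →ₐ[K] A := Ideal.Quotient.liftₐ I (MvPolynomial.aeval x) hker
  have hsurj : Function.Surjective g := by
    intro a
    have ha : a ∈ Algebra.adjoin K (Set.range x) := hgen ▸ Algebra.mem_top
    rw [Algebra.adjoin_range_eq_range_aeval] at ha
    obtain ⟨P, rfl⟩ := ha
    exact ⟨Ideal.Quotient.mk I P, rfl⟩
  have hrk : Module.finrank K (MvPolynomial ι K ⧸ I) = Module.finrank K A :=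
    le_antisymm (hle.trans hrank) (LinearMap.finrank_le_finrank_of_surjective
      (f := g.toLinearMap) hsurj)
  have hinj : Function.Injective g :=
    (LinearMap.injective_iff_surjective_of_finrank_eq_finrank (f := g.toLinearMap) hrk).2 hsurj
  exact ⟨(AlgEquiv.ofBijective g ⟨hinj, hsurj⟩).symm⟩

theorem CounitalComul.exists_restrict {K A : Type*} [Field K] [CommRing A] [Algebra K A]
    (S : CounitalComul K A) (B : Subalgebra K A)
    (hB : ∀ b ∈ B, S.comul b ∈ (Algebra.TensorProduct.map B.val B.val).range) :
    ∃ S' : CounitalComul K B, ∀ b : B, S'.counit b = S.counit b := by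
  let Γ : B ⊗[K] B →ₐ[K] A ⊗[K] A := Algebra.TensorProduct.map B.val B.val
  have hΓ : Function.Injective Γ :=
    TensorProduct.map_injective_of_flat_flat B.val.toLinearMap B.val.toLinearMap
      Subtype.val_injective Subtype.val_injective
  let δ : B →ₐ[K] B ⊗[K] B := (AlgEquiv.ofInjective Γ hΓ).symm.toAlgHom.comp
    ((S.comul.comp B.val).codRestrict Γ.range fun b => hB b b.2)
  have hδ (b : B) : Γ (δ b) = S.comul b :=
    congrArg Subtype.val ((AlgEquiv.ofInjective Γ hΓ).apply_symm_apply
      ⟨S.comul b, hB b b.2⟩)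
  let ε : B →ₐ[K] K := S.counit.comp B.val
  have hr (t : B ⊗[K] B) : B.val.toLinearMap.lTensor K (ε.toLinearMap.rTensor B t) =
      S.counit.toLinearMap.rTensor A (Γ t) := by
    induction t with
    | zero => simp
    | add s t hs ht => simp only [map_add, hs, ht]
    | tmul a b => simp [Γ, ε]
  have hl (t : B ⊗[K] B) : B.val.toLinearMap.rTensor K (ε.toLinearMap.lTensor B t) =
      S.counit.toLinearMap.lTensor A (Γ t) := by
    induction t with
    | zero => simp
    | add s t hs ht => simp only [map_add, hs, ht]
    | tmul a b => simp [Γ, ε]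
  refine ⟨⟨ε, δ, fun b => ?_, fun b => ?_⟩, fun _ => rfl⟩
  · refine Module.Flat.lTensor_preserves_injective_linearMap (M := K) B.val.toLinearMap
      Subtype.val_injective ?_
    rw [hr, hδ, S.rTensor_counit]
    simp
  · refine Module.Flat.rTensor_preserves_injective_linearMap (M := K) B.val.toLinearMap
      Subtype.val_injective ?_
    rw [hl, hδ, S.lTensor_counit]
    simp

/-- The subalgebra of `p`-th powers of an algebra over an algebraically closed field of
characteristic `p`. -/
def powSubalgebra (K A : Type*) [Field K] [IsAlgClosed K] [CommRing A] [Algebra K A] (p : ℕ)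
    [Fact p.Prime] [CharP A p] : Subalgebra K A where
  __ := (frobenius A p).rangeS
  algebraMap_mem' c := by
    obtain ⟨d, rfl⟩ := IsAlgClosed.exists_pow_nat_eq c (Fact.out : p.Prime).pos
    exact ⟨algebraMap K A d, by simp [frobenius_def]⟩

theorem pow_mem_powSubalgebra (K : Type*) {A : Type*} [Field K] [IsAlgClosed K] [CommRing A]
    [Algebra K A] (p : ℕ) [Fact p.Prime] [CharP A p] (a : A) : a ^ p ∈ powSubalgebra K A p :=
  ⟨a, rfl⟩

theorem exists_pow_eq_of_mem_powSubalgebra {K A : Type*} [Field K] [IsAlgClosed K] [CommRing A]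
    [Algebra K A] {p : ℕ} [Fact p.Prime] [CharP A p] {b : A} (hb : b ∈ powSubalgebra K A p) :
    ∃ a, a ^ p = b :=
  hb

theorem CounitalComul.exists_powSubalgebra {K A : Type*} [Field K] [IsAlgClosed K] [CommRing A]
    [Algebra K A] (p : ℕ) [Fact p.Prime] [CharP A p] (S : CounitalComul K A) :
    ∃ S' : CounitalComul K (powSubalgebra K A p), ∀ b, S'.counit b = S.counit b := by
  have hchar : CharP (A ⊗[K] A) p := by
    have : Nontrivial A := S.counit.toRingHom.domain_nontrivial
    have : Nontrivial (A ⊗[K] A) :=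
      (Algebra.TensorProduct.lmul' K (S := A)).toRingHom.domain_nontrivial
    have : CharP K p := (algebraMap K A).charP (algebraMap K A).injective p
    exact charP_of_injective_algebraMap (algebraMap K (A ⊗[K] A)).injective p
  refine S.exists_restrict _ fun b hb => ?_
  obtain ⟨a, rfl⟩ := exists_pow_eq_of_mem_powSubalgebra hb
  rw [map_pow]
  generalize S.comul a = t
  induction t with
  | zero => rw [zero_pow (Fact.out : p.Prime).ne_zero]; exact zero_mem _
  | add s t hs ht => rw [add_pow_char]; exact add_mem hs ht
  | tmul a b =>
    exact ⟨⟨_, pow_mem_powSubalgebra K p a⟩ ⊗ₜ ⟨_, pow_mem_powSubalgebra K p b⟩, by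
      simp [Algebra.TensorProduct.tmul_pow]⟩

/-- The `p`-th power map onto the subalgebra of `p`-th powers. -/
def powHom (K A : Type*) [Field K] [IsAlgClosed K] [CommRing A] [Algebra K A] (p : ℕ)
    [Fact p.Prime] [CharP A p] : A →+* powSubalgebra K A p :=
  (frobenius A p).codRestrict (powSubalgebra K A p) (pow_mem_powSubalgebra K p)

theorem mkQ_mem_span_of_mem_adjoin {K A ι : Type*} [Field K] [CommRing A] [Algebra K A]
    (ε : A →ₐ[K] K) (x : ι → A) {c : A} (hc : c ∈ Algebra.adjoin K (Set.range x)) :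
    (pointConstants ε).mkQ c ∈ Submodule.span K (Set.range ((pointConstants ε).mkQ ∘ x)) := by
  induction hc using Algebra.adjoin_induction with
  | mem a ha =>
    obtain ⟨i, rfl⟩ := ha
    exact Submodule.subset_span ⟨i, rfl⟩
  | algebraMap r => rw [mkQ_pointConstants_algebraMap]; exact zero_mem _
  | add a b _ _ ha hb => rw [map_add]; exact add_mem ha hb
  | mul a b _ _ ha hb =>
    rw [mkQ_pointConstants_mul]
    exact add_mem (Submodule.smul_mem _ _ hb) (Submodule.smul_mem _ _ ha)

theorem powHom_mem_pointConstants {K A : Type*} [Field K] [IsAlgClosed K] [CommRing A]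
    [Algebra K A] {p : ℕ} [Fact p.Prime] [CharP A p] (ε : A →ₐ[K] K)
    (ε' : powSubalgebra K A p →ₐ[K] K) (hε : ∀ b, ε' b = ε b) {a : A}
    (ha : a ∈ pointConstants ε) : powHom K A p a ∈ pointConstants ε' := by
  obtain ⟨c', hc', u, hu, rfl⟩ := Submodule.mem_sup.1 ha
  obtain ⟨c, rfl⟩ := Submodule.mem_span_singleton.1 hc'
  rw [map_add]
  refine add_mem (Submodule.mem_sup_left (Submodule.mem_span_singleton.2 ⟨c ^ p, ?_⟩))
    (Submodule.mem_sup_right ?_)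
  · refine Subtype.ext ?_
    change c ^ p • (1 : A) = (c • 1) ^ p
    rw [smul_pow, one_pow]
  · have hle : RingHom.ker ε ≤ (RingHom.ker ε').comap (powHom K A p) := fun b hb => by
      change ε' _ = 0
      rw [hε]
      change ε (b ^ p) = 0
      rw [map_pow, show ε b = 0 from hb, zero_pow (Fact.out : p.Prime).ne_zero]
    exact (Ideal.pow_right_mono hle 2).trans (Ideal.le_comap_pow _ 2) hu

theorem exists_mem_adjoin_powHom_eq {K A ι : Type*} [Field K] [IsAlgClosed K] [CommRing A]
    [Algebra K A] {p : ℕ} [Fact p.Prime] [CharP A p] (x : ι → A) {b : powSubalgebra K A p}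
    (hb : b ∈ Algebra.adjoin K (Set.range (powHom K A p ∘ x))) :
    ∃ c ∈ Algebra.adjoin K (Set.range x), powHom K A p c = b := by
  induction hb using Algebra.adjoin_induction with
  | mem a ha =>
    obtain ⟨i, rfl⟩ := ha
    exact ⟨x i, Algebra.subset_adjoin ⟨i, rfl⟩, rfl⟩
  | algebraMap r =>
    obtain ⟨d, rfl⟩ := IsAlgClosed.exists_pow_nat_eq r (Fact.out : p.Prime).pos
    exact ⟨algebraMap K A d, Subalgebra.algebraMap_mem _ _, Subtype.ext (map_pow _ d p).symm⟩
  | add a b _ _ ha hb =>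
    obtain ⟨c, hc, rfl⟩ := ha
    obtain ⟨d, hd, rfl⟩ := hb
    exact ⟨c + d, add_mem hc hd, map_add _ _ _⟩
  | mul a b _ _ ha hb =>
    obtain ⟨c, hc, rfl⟩ := ha
    obtain ⟨d, hd, rfl⟩ := hb
    exact ⟨c * d, mul_mem hc hd, map_mul _ _ _⟩

theorem linearIndependent_mkQ_of_powHom {K A ι : Type*} [Field K] [IsAlgClosed K] [CommRing A]
    [Algebra K A] [Fintype ι] {p : ℕ} [Fact p.Prime] [CharP A p] (ε : A →ₐ[K] K)
    (ε' : powSubalgebra K A p →ₐ[K] K) (hε : ∀ b, ε' b = ε b) (x : ι → A)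
    (h : LinearIndependent K ((pointConstants ε').mkQ ∘ powHom K A p ∘ x)) :
    LinearIndependent K ((pointConstants ε).mkQ ∘ x) := by
  rw [Fintype.linearIndependent_iff] at h ⊢
  intro c hc i
  have h1 : ∑ i, c i • x i ∈ pointConstants ε := by
    rw [← Submodule.Quotient.mk_eq_zero, ← Submodule.mkQ_apply]
    simpa only [map_sum, map_smul, Function.comp_apply] using hc
  have h2 := powHom_mem_pointConstants ε ε' hε h1
  have hsmul (c : K) (a : A) : powHom K A p (c • a) = c ^ p • powHom K A p a :=
    Subtype.ext (smul_pow c a p)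
  rw [← Submodule.Quotient.mk_eq_zero, ← Submodule.mkQ_apply] at h2
  simp only [map_sum, hsmul, map_smul] at h2
  exact eq_zero_of_pow_eq_zero (h _ h2 i)

theorem CounitalComul.isNilpotent_ker {K A : Type*} [Field K] [CommRing A] [Algebra K A]
    [Module.Finite K A] (S : CounitalComul K A) (hnil : ∀ a, S.counit a = 0 → IsNilpotent a) :
    IsNilpotent (RingHom.ker S.counit) := by
  have : IsNoetherianRing A := IsNoetherianRing.of_finite K A
  exact (Ideal.FG.isNilpotent_iff_le_nilradical (IsNoetherian.noetherian _)).2 hnil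

theorem CounitalComul.exists_truncated_generators {K : Type} [Field K] [IsAlgClosed K] (p : ℕ)
    [Fact p.Prime] [CharP K p] (N : ℕ) :
    ∀ (A : Type) [CommRing A] [Algebra K A] [Module.Finite K A] (S : CounitalComul K A),
      (∀ a, S.counit a = 0 → a ^ p ^ N = 0) →
      ∃ (ι : Type) (_ : Fintype ι) (x : ι → A) (e : ι → ℕ), (∀ i, 1 ≤ e i) ∧
        (∀ i, x i ^ p ^ e i = 0) ∧ Algebra.adjoin K (Set.range x) = ⊤ ∧
        ∏ i, p ^ e i ≤ Module.finrank K A ∧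
        LinearIndependent K ((pointConstants S.counit).mkQ ∘ x) := by
  have hp : p.Prime := Fact.out
  induction N with
  | zero =>
    intro A _ _ _ S hN
    have : Nontrivial A := S.counit.toRingHom.domain_nontrivial
    refine ⟨Empty, inferInstance, Empty.elim, Empty.elim, fun i => i.elim, fun i => i.elim, ?_,
      by simpa using Nat.one_le_iff_ne_zero.2 Module.finrank_pos.ne', linearIndependent_empty_type⟩
    refine eq_top_iff.2 fun a _ => ?_
    have := hN (a - algebraMap K A (S.counit a)) (by simp)
    rw [pow_zero, pow_one, sub_eq_zero] at this
    exact this ▸ Subalgebra.algebraMap_mem _ _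
  | succ N ih =>
    intro A _ _ _ S hN
    classical
    have : Nontrivial A := S.counit.toRingHom.domain_nontrivial
    have : CharP A p := charP_of_injective_algebraMap (algebraMap K A).injective p
    have hnil (a : A) (ha : S.counit a = 0) : IsNilpotent a := ⟨_, hN a ha⟩
    obtain ⟨S', hS'⟩ := S.exists_powSubalgebra p
    obtain ⟨ι, _, y, f, hf1, hy, hgen, hrank, hind⟩ := ih (powSubalgebra K A p) S' fun b hb => by
      obtain ⟨a, ha⟩ := exists_pow_eq_of_mem_powSubalgebra b.2
      rw [hS', ← ha, map_pow] at hb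
      refine Subtype.ext ?_
      change (b : A) ^ p ^ N = 0
      rw [← ha, ← pow_mul, ← pow_succ']
      exact hN a (eq_zero_of_pow_eq_zero hb)
    choose x hx using fun i => exists_pow_eq_of_mem_powSubalgebra (y i).2
    obtain rfl : y = powHom K A p ∘ x := funext fun i => Subtype.ext (hx i).symm
    have hxf (i : ι) : x i ^ p ^ (f i + 1) = 0 := by
      rw [pow_succ', pow_mul]
      exact congrArg Subtype.val (hy i)
    have hxind := linearIndependent_mkQ_of_powHom S.counit S'.counit hS' x hind
    let π := (pointConstants S.counit).mkQ
    let v : ι ⊕ {z : A // z ^ p = 0} → A := Sum.elim x Subtype.val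
    let g : ι ⊕ {z : A // z ^ p = 0} → ℕ := Sum.elim f 0
    have hv (j) : v j ^ p ^ (g j + 1) = 0 := by
      rcases j with i | z
      · exact hxf i
      · simpa [v, g] using z.2
    have hs : LinearIndepOn K (π ∘ v) (Set.range Sum.inl) :=
      (linearIndepOn_range_iff Sum.inl_injective _).2 hxind
    let b := hs.extend (Set.subset_univ _)
    have hbind : LinearIndependent K (π ∘ (fun j : b => v j)) := hs.linearIndepOn_extend _
    have : Finite b := hbind.finite
    have : Fintype b := Fintype.ofFinite b
    have hεv (j) : S.counit (v j) = 0 := by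
      have := congrArg S.counit (hv j)
      rw [map_pow, map_zero] at this
      exact eq_zero_of_pow_eq_zero this
    have hspan_v : Submodule.span K (Set.range (π ∘ v)) = ⊤ := by
      refine eq_top_iff.2 fun q _ => ?_
      obtain ⟨a, rfl⟩ := Submodule.mkQ_surjective _ q
      obtain ⟨c, hc, hca⟩ := exists_mem_adjoin_powHom_eq x (b := powHom K A p a)
        (hgen ▸ Algebra.mem_top)
      have hz : (a - c) ^ p = 0 := by
        rw [sub_pow_char]
        exact sub_eq_zero.2 (congrArg Subtype.val hca).symm
      rw [← add_sub_cancel c a, map_add]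
      refine add_mem (Submodule.span_mono ?_ (mkQ_mem_span_of_mem_adjoin S.counit x hc))
        (Submodule.subset_span ⟨Sum.inr ⟨a - c, hz⟩, rfl⟩)
      rintro _ ⟨i, rfl⟩
      exact ⟨Sum.inl i, rfl⟩
    have hspan : Submodule.span K (Set.range (π ∘ (fun j : b => v j))) = ⊤ := by
      rw [← top_le_iff, ← hspan_v]
      have := hs.image_subset_span_image_extend (Set.subset_univ _)
      rw [Set.image_univ] at this
      refine (Submodule.span_le.2 this).trans (Submodule.span_mono ?_)
      rintro _ ⟨j, hj, rfl⟩
      exact ⟨⟨j, hj⟩, rfl⟩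
    refine ⟨b, inferInstance, fun j => v j, fun j => g j + 1, fun j => Nat.le_add_left _ _,
      fun j => hv j, adjoin_eq_top_of_span_mkQ_eq_top S.counit (S.isNilpotent_ker hnil) _
        (fun j => hεv j) hspan, ?_, hbind⟩
    obtain ⟨D, hD⟩ := exists_dual_derivations S hnil _ hbind
    have hprod : ∏ i, p ^ f i = ∏ j : b, p ^ g j :=
      Fintype.prod_of_injective
        (fun i => (⟨Sum.inl i, hs.subset_extend (Set.subset_univ _) ⟨i, rfl⟩⟩ : b))
        (fun i j h => Sum.inl_injective (congrArg Subtype.val h)) _ _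
        (by
          rintro ⟨i | z, hj⟩ hnot
          · exact absurd ⟨i, rfl⟩ hnot
          · rfl)
        fun i => rfl
    calc ∏ j : b, p ^ (g j + 1) = p ^ Fintype.card b * ∏ i, p ^ f i := by
          rw [hprod, ← Finset.card_univ, ← Finset.prod_const, ← Finset.prod_mul_distrib]
          simp only [pow_succ']
      _ ≤ p ^ Fintype.card b * Module.finrank K (powSubalgebra K A p) :=
          Nat.mul_le_mul_left _ hrank
      _ ≤ Module.finrank K A := by
          refine card_pow_mul_finrank_le _ (fun k h0 hk hk0 => ?_) _ D hD fun i b hb => ?_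
          · exact Nat.not_dvd_of_pos_of_lt h0 hk ((CharP.cast_eq_zero_iff K p k).1 hk0)
          · obtain ⟨a, rfl⟩ := exists_pow_eq_of_mem_powSubalgebra hb
            rw [Derivation.leibniz_pow, ← Nat.cast_smul_eq_nsmul A, CharP.cast_eq_zero, zero_smul]

theorem CounitalComul.adjoin_empty_eq_top_of_charZero {K A : Type*} [Field K] [CharZero K]
    [CommRing A] [Algebra K A] [Module.Finite K A] (S : CounitalComul K A)
    (hnil : ∀ a, S.counit a = 0 → IsNilpotent a) :
    Algebra.adjoin K (∅ : Set A) = ⊤ := by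
  have : Nontrivial A := S.counit.toRingHom.domain_nontrivial
  have : CharZero A := charZero_of_injective_algebraMap (algebraMap K A).injective
  have hzero (a : A) : (pointConstants S.counit).mkQ a = 0 := by
    by_contra hne
    set w := a - algebraMap K A (S.counit a) with hw
    have hπw : (pointConstants S.counit).mkQ w ≠ 0 := by
      rwa [hw, map_sub, mkQ_pointConstants_algebraMap, sub_zero]
    obtain ⟨D, hD⟩ := exists_dual_derivations S hnil (fun _ : Unit => w)
      (linearIndependent_unique_iff.2 hπw)
    have hD1 : D () w = 1 := by simpa using hD () ()
    have hpow (k : ℕ) : w ^ k ≠ 0 := by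
      induction k with
      | zero => simp
      | succ k ih =>
        intro h0
        have h1 := congrArg (D ()) h0
        rw [Derivation.leibniz_pow, hD1, map_zero, Nat.add_sub_cancel, smul_eq_mul, mul_one,
          ← Nat.cast_smul_eq_nsmul K] at h1
        exact ih ((smul_eq_zero.1 h1).resolve_left (Nat.cast_ne_zero.2 k.succ_ne_zero))
    obtain ⟨k, hk⟩ := hnil w (by simp [hw])
    exact hpow k hk
  have := adjoin_eq_top_of_span_mkQ_eq_top S.counit (S.isNilpotent_ker hnil) (Empty.elim)
    (fun i => i.elim) (eq_top_iff.2 fun q _ => by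
      obtain ⟨a, rfl⟩ := Submodule.mkQ_surjective _ q
      rw [hzero]
      exact zero_mem _)
  rwa [Set.range_eq_empty] at this

theorem nonempty_algEquiv_of_adjoin_empty {K A : Type*} [Field K] [CommRing A] [Nontrivial A]
    [Algebra K A] (h : Algebra.adjoin K (∅ : Set A) = ⊤) : Nonempty (A ≃ₐ[K] K) := by
  rw [Algebra.adjoin_empty] at h
  exact ⟨Subalgebra.topEquiv.symm.trans
    ((Subalgebra.equivOfEq _ _ h.symm).trans (Algebra.botEquiv K A))⟩

theorem isNilpotent_of_forall_algHom_eq {K A : Type*} [Field K] [IsAlgClosed K] [CommRing A]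
    [Algebra K A] [Algebra.FiniteType K A] (f : A →ₐ[K] K) (hf : ∀ g : A →ₐ[K] K, g = f) {a : A}
    (ha : f a = 0) : IsNilpotent a := by
  have : IsJacobsonRing A := isJacobsonRing_of_finiteType (A := K)
  rw [← mem_nilradical, nilradical, Ideal.radical_eq_jacobson, Ideal.jacobson, Ideal.mem_sInf]
  rintro M ⟨-, hM⟩
  let := Ideal.Quotient.field M
  have : Module.Finite K (A ⧸ M) := finite_of_finite_type_of_isJacobsonRing K (A ⧸ M)
  let e : K ≃ₐ[K] A ⧸ M := AlgEquiv.ofBijective (Algebra.ofId K (A ⧸ M))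
    IsAlgClosed.algebraMap_bijective_of_isIntegral
  have h := DFunLike.congr_fun (hf (e.symm.toAlgHom.comp (Ideal.Quotient.mkₐ K M))) a
  rw [ha] at h
  exact Ideal.Quotient.eq_zero_iff_mem.1 ((map_eq_zero_iff e.symm e.symm.injective).1 h)

/-- The standard counital comultiplication of a bialgebra. -/
def CounitalComul.ofBialgebra (K H : Type*) [Field K] [CommRing H] [Bialgebra K H] :
    CounitalComul K H where
  counit := Bialgebra.counitAlgHom K H
  comul := Bialgebra.comulAlgHom K H
  rTensor_counit := Coalgebra.rTensor_counit_comul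
  lTensor_counit := Coalgebra.lTensor_counit_comul

theorem finite_of_forall_isNilpotent {K A : Type*} [Field K] [CommRing A]
    [Algebra K A] [Algebra.FiniteType K A] (f : A →ₐ[K] K)
    (hnil : ∀ a, f a = 0 → IsNilpotent a) : Module.Finite K A := by
  have : Algebra.IsIntegral K A := ⟨fun a => by
    obtain ⟨n, hn⟩ := hnil (a - algebraMap K A (f a)) (by simp)
    have h : IsIntegral K (a - algebraMap K A (f a)) :=
      ⟨Polynomial.X ^ n, Polynomial.monic_X_pow n, by simpa using hn⟩
    simpa using h.add (isIntegral_algebraMap (x := f a))⟩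
  exact Algebra.IsIntegral.finite

theorem existsUnique_algHom_quotient_span_X_pow {K ι : Type*} [Field K] (d : ι → ℕ)
    (hd : ∀ i, d i ≠ 0) :
    ∃ f : (MvPolynomial ι K ⧸
      Ideal.span (Set.range fun i => (MvPolynomial.X i : MvPolynomial ι K) ^ d i)) →ₐ[K] K,
      ∀ g, g = f := by
  set I := Ideal.span (Set.range fun i => (MvPolynomial.X i : MvPolynomial ι K) ^ d i) with hI
  have hI0 : I ≤ RingHom.ker (MvPolynomial.aeval 0 : MvPolynomial ι K →ₐ[K] K) := by
    refine Ideal.span_le.2 ?_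
    rintro _ ⟨i, rfl⟩
    simp [RingHom.mem_ker, hd i]
  have hX (g : (MvPolynomial ι K ⧸ I) →ₐ[K] K) (i : ι) :
      g (Ideal.Quotient.mkₐ K I (MvPolynomial.X i)) = 0 := by
    refine eq_zero_of_pow_eq_zero (n := d i) ?_
    rw [← map_pow, ← map_pow]
    have : Ideal.Quotient.mkₐ K I (MvPolynomial.X i ^ d i) = 0 :=
      Ideal.Quotient.eq_zero_iff_mem.2 (Ideal.subset_span ⟨i, rfl⟩)
    rw [this, map_zero]
  refine ⟨Ideal.Quotient.liftₐ I (MvPolynomial.aeval 0) hI0, fun g => ?_⟩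
  refine Ideal.Quotient.algHom_ext K (MvPolynomial.algHom_ext fun i => ?_)
  exact (hX g i).trans (hX (Ideal.Quotient.liftₐ I (MvPolynomial.aeval 0) hI0) i).symm

theorem AlgEquiv.exists_forall_algHom_eq {K A B : Type*} [Field K] [CommRing A] [Algebra K A]
    [CommRing B] [Algebra K B] (e : A ≃ₐ[K] B) (h : ∃ f : B →ₐ[K] K, ∀ g : B →ₐ[K] K, g = f) :
    ∃ f : A →ₐ[K] K, ∀ g : A →ₐ[K] K, g = f := by
  obtain ⟨f, hf⟩ := h
  refine ⟨f.comp e.toAlgHom, fun g => AlgHom.ext fun a => ?_⟩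
  simpa using DFunLike.congr_fun (hf (g.comp e.symm.toAlgHom)) (e a)

/-- Let `K` be an algebraically closed field and `H` a commutative
Hopf algebra over `K` that is finitely generated as a `K`-algebra.  Then there is
exactly one `K`-algebra homomorphism `H → K` if and only if either `H ≅ K` as
`K`-algebras, or `K` has prime characteristic `p` and
`H ≅ K[x₁,…,xₙ]/(x₁^{p^{e₁}},…,xₙ^{p^{eₙ}})` for some `n ≥ 1` and positive
exponents `e₁,…,eₙ`. -/
theorem stmt15 (K : Type) [Field K] [IsAlgClosed K]
    (H : Type) [CommRing H] [HopfAlgebra K H] (hft : Algebra.FiniteType K H) :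
    (∃ f : H →ₐ[K] K, ∀ g : H →ₐ[K] K, g = f) ↔
    (Nonempty (H ≃ₐ[K] K) ∨
      ∃ p : ℕ, p.Prime ∧ CharP K p ∧
        ∃ n : ℕ, 1 ≤ n ∧ ∃ e : Fin n → ℕ, (∀ i, 1 ≤ e i) ∧
          Nonempty (H ≃ₐ[K]
            (MvPolynomial (Fin n) K ⧸
              Ideal.span (Set.range fun i : Fin n =>
                (MvPolynomial.X i : MvPolynomial (Fin n) K) ^ p ^ e i)))) := by
  constructor
  · rintro ⟨f, hf⟩
    let S := CounitalComul.ofBialgebra K H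
    have : Nontrivial H := f.toRingHom.domain_nontrivial
    have hnil (a : H) (ha : S.counit a = 0) : IsNilpotent a :=
      isNilpotent_of_forall_algHom_eq f hf (hf S.counit ▸ ha)
    have : Module.Finite K H := finite_of_forall_isNilpotent S.counit hnil
    obtain ⟨p, hp⟩ := CharP.exists K
    rcases CharP.char_is_prime_or_zero K p with hpp | rfl
    · have : Fact p.Prime := ⟨hpp⟩
      obtain ⟨N, hN⟩ := S.isNilpotent_ker hnil
      obtain ⟨ι, _, x, e, he, hx, hgen, hrank, -⟩ := S.exists_truncated_generators p N H
        fun a ha => pow_eq_zero_of_le (N.lt_pow_self hpp.one_lt).le (by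
          have := Ideal.pow_mem_pow (show a ∈ RingHom.ker S.counit from ha) N
          rwa [hN] at this)
      by_cases hι : IsEmpty ι
      · rw [Set.range_eq_empty] at hgen
        exact Or.inl (nonempty_algEquiv_of_adjoin_empty hgen)
      · rw [not_isEmpty_iff] at hι
        let s := (Fintype.equivFin ι).symm
        refine Or.inr ⟨p, hpp, hp, Fintype.card ι, Fintype.card_pos, e ∘ s, fun i => he _, ?_⟩
        refine nonempty_algEquiv_quotient_span_X_pow (x ∘ s) (fun i => p ^ e (s i))
          (fun i => hx _) ?_ ?_
        · rwa [s.surjective.range_comp]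
        · rwa [s.prod_comp fun i => p ^ e i]
    · have : CharZero K := CharP.charP_to_charZero K
      exact Or.inl (nonempty_algEquiv_of_adjoin_empty (S.adjoin_empty_eq_top_of_charZero hnil))
  · rintro (⟨⟨e⟩⟩ | ⟨p, hp, _, n, _, e, _, ⟨φ⟩⟩)
    · exact e.exists_forall_algHom_eq ⟨AlgHom.id K K, fun g => Subsingleton.elim _ _⟩
    · exact φ.exists_forall_algHom_eq
        (existsUnique_algHom_quotient_span_X_pow _ fun i => pow_ne_zero _ hp.ne_zero)
end

section
/- Let K be an algebraically closed field and let A be a two-dimensional evolution algebra over K, i.e. a 2-dimensional K-vector space with bilinear product admitting a basis e₁,e₂ with e₁e₂ = e₂e₁ = 0. Then the following are equivalent: (1) there exist scalars λ₀,λ₁,λ₂,λ₃ ∈ K, a commutative associative (not necessarily unital) K-algebra B with a K-linear involution *, and an injective K-linear map σ : A → B such that σ(uv) = λ₀σ(u)σ(v) + λ₁σ(u)σ(v)* + λ₂σ(u)*σ(v) + λ₃σ(u)*σ(v)* for all u,v ∈ A (a faithful associative and commutative representation); (2) there exists a K-algebra automorphism of A different from the identity. -/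
/-- A faithful associative and commutative representation of the (nonassociative)
`K`-algebra `A`: scalars `λ₀,λ₁,λ₂,λ₃ ∈ K`, a commutative associative (not necessarily
unital) `K`-algebra `B` with a `K`-linear involution `s`, and an injective `K`-linear
map `σ : A → B` with `σ(uv) = λ₀σ(u)σ(v) + λ₁σ(u)σ(v)* + λ₂σ(u)*σ(v) + λ₃σ(u)*σ(v)*`
for all `u, v ∈ A`. -/
structure FaithfulRep (K : Type) [Field K] (A : Type) [NonUnitalNonAssocRing A]
    [Module K A] [SMulCommClass K A A] [IsScalarTower K A A] : Type 1 where
  B : Type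
  [ringB : NonUnitalCommRing B]
  [modB : Module K B]
  [smulB : SMulCommClass K B B]
  [towerB : IsScalarTower K B B]
  l0 : K
  l1 : K
  l2 : K
  l3 : K
  s : B →ₗ[K] B
  hsmul : ∀ x y : B, s (x * y) = s x * s y
  hsinv : ∀ x : B, s (s x) = x
  σ : A →ₗ[K] B
  inj : Function.Injective σ
  rep : ∀ u v : A, σ (u * v) =
    l0 • (σ u * σ v) + l1 • (σ u * s (σ v)) + l2 • (s (σ u) * σ v) +
      l3 • (s (σ u) * s (σ v))

open Module

section Plane

variable {K : Type} [Field K] {A : Type} [AddCommGroup A] [Module K A]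

theorem exists_coords {e₁ e₂ : A} (hA : finrank K A = 2) (h : LinearIndependent K ![e₁, e₂])
    (u : A) : ∃ s t : K, u = s • e₁ + t • e₂ := by
  have h1 := h.span_eq_top_of_card_eq_finrank (by simp [hA])
  have h2 : u ∈ Submodule.span K (Set.range ![e₁, e₂]) := h1 ▸ Submodule.mem_top
  simp only [Matrix.range_cons, Matrix.range_empty, Set.union_empty, Set.singleton_union,
    Submodule.mem_span_pair] at h2
  obtain ⟨s, t, h⟩ := h2
  exact ⟨s, t, h.symm⟩

theorem exists_linearMap {M : Type} [AddCommGroup M] [Module K M] {e₁ e₂ : A}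
    (hA : finrank K A = 2) (h : LinearIndependent K ![e₁, e₂]) (m₁ m₂ : M) :
    ∃ f : A →ₗ[K] M, f e₁ = m₁ ∧ f e₂ = m₂ := by
  let b := basisOfLinearIndependentOfCardEqFinrank h (by simp [hA])
  have hb : ⇑b = ![e₁, e₂] := coe_basisOfLinearIndependentOfCardEqFinrank _ _
  refine ⟨b.constr K ![m₁, m₂], ?_, ?_⟩
  · simpa [hb] using b.constr_basis K ![m₁, m₂] 0
  · simpa [hb] using b.constr_basis K ![m₁, m₂] 1

theorem injective_of_coords {M : Type} [AddCommGroup M] [Module K M] {e₁ e₂ : A}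
    (hA : finrank K A = 2) (h : LinearIndependent K ![e₁, e₂]) {f : A →ₗ[K] M}
    (hf : LinearIndependent K ![f e₁, f e₂]) : Function.Injective f := by
  rw [injective_iff_map_eq_zero]
  intro u hu
  obtain ⟨s, t, rfl⟩ := exists_coords hA h u
  obtain ⟨rfl, rfl⟩ := LinearIndependent.pair_iff.1 hf s t (by simpa using hu)
  simp

end Plane

section General

variable {K : Type} [Field K] {A : Type} [NonUnitalNonAssocRing A] [Module K A]

/-- `X (u * v)` is the value at `X u`, `X v` of the polynomial `p` with coefficients `l`, where
`Y u` plays the role of the conjugate of `X u`. -/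
def IsTwisted {C : Type} [CommRing C] [Algebra K C] (l : Fin 4 → K) (X Y : A →ₗ[K] C) : Prop :=
  ∀ u v : A, X (u * v) = l 0 • (X u * X v) + l 1 • (X u * Y v) + l 2 • (Y u * X v) +
    l 3 • (Y u * Y v)

/-- A finite set of elements that are combinations of their own products is represented by zero as
soon as it is represented by nilpotents. -/
theorem IsTwisted.eq_zero_of_isNilpotent {C : Type} [CommRing C] [Algebra K C]
    {l : Fin 4 → K} {X Y : A →ₗ[K] C} (hX : IsTwisted l X Y) (hY : IsTwisted l Y X)
    {S : Set A} (hS : S.Finite)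
    (hprod : ∀ t ∈ S, t ∈ Submodule.span K {x | ∃ u ∈ S, ∃ v ∈ S, x = u * v})
    (hXS : ∀ t ∈ S, IsNilpotent (X t)) (hYS : ∀ t ∈ S, IsNilpotent (Y t)) :
    ∀ t ∈ S, X t = 0 := by
  set J : Ideal C := Ideal.span (X '' S ∪ Y '' S) with hJ
  have memX : ∀ t ∈ S, X t ∈ J := fun t ht => Ideal.subset_span (.inl ⟨t, ht, rfl⟩)
  have memY : ∀ t ∈ S, Y t ∈ J := fun t ht => Ideal.subset_span (.inr ⟨t, ht, rfl⟩)
  have hfg : J.FG := Submodule.fg_span ((hS.image X).union (hS.image Y))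
  have hnil : IsNilpotent J := by
    rw [hfg.isNilpotent_iff_le_nilradical, hJ, Ideal.span_le]
    rintro _ (⟨t, ht, rfl⟩ | ⟨t, ht, rfl⟩)
    exacts [hXS t ht, hYS t ht]
  have smem : ∀ (k : K) {c : C}, c ∈ J * J → k • c ∈ J * J := fun k c hc => by
    rw [Algebra.smul_def]; exact Ideal.mul_mem_left _ _ hc
  have hsq : ∀ t ∈ S, X t ∈ J * J ∧ Y t ∈ J * J := fun t ht => by
    refine Submodule.span_induction (p := fun x _ => X x ∈ J * J ∧ Y x ∈ J * J) ?_ ?_ ?_ ?_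
      (hprod t ht)
    · rintro _ ⟨u, hu, v, hv, rfl⟩
      have xx := Ideal.mul_mem_mul (memX u hu) (memX v hv)
      have xy := Ideal.mul_mem_mul (memX u hu) (memY v hv)
      have yx := Ideal.mul_mem_mul (memY u hu) (memX v hv)
      have yy := Ideal.mul_mem_mul (memY u hu) (memY v hv)
      rw [hX u v, hY u v]
      exact ⟨add_mem (add_mem (add_mem (smem _ xx) (smem _ xy)) (smem _ yx)) (smem _ yy),
        add_mem (add_mem (add_mem (smem _ yy) (smem _ yx)) (smem _ xy)) (smem _ xx)⟩
    · simp
    · rintro x y _ _ ⟨h1, h2⟩ ⟨h3, h4⟩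
      exact ⟨by rw [map_add]; exact add_mem h1 h3, by rw [map_add]; exact add_mem h2 h4⟩
    · rintro k x _ ⟨h1, h2⟩
      exact ⟨by rw [map_smul]; exact smem k h1, by rw [map_smul]; exact smem k h2⟩
  have hidem : IsIdempotentElem J := by
    refine le_antisymm Ideal.mul_le_left ?_
    rw [hJ, Ideal.span_le, ← hJ]
    rintro _ (⟨t, ht, rfl⟩ | ⟨t, ht, rfl⟩)
    exacts [(hsq t ht).1, (hsq t ht).2]
  have hzero : J = ⊥ := by
    obtain ⟨n, hn⟩ := hnil
    rw [← hidem.pow_succ_eq n, pow_succ, hn, zero_mul, Ideal.zero_eq_bot]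
  intro t ht
  simpa [hzero] using memX t ht

variable (K A) in
/-- The algebra `A` has an automorphism different from the identity. -/
def HasNontrivialAut : Prop :=
  ∃ f : A →ₗ[K] A, Function.Bijective f ∧ (∀ u v : A, f (u * v) = f u * f v) ∧
    f ≠ LinearMap.id

/-- Consequence of the Nullstellensatz: an element on which all scalar solutions of the
representation equations vanish is represented by nilpotent elements. -/
theorem IsTwisted.isNilpotent [IsAlgClosed K] {C : Type} [CommRing C] [Algebra K C]
    {l : Fin 4 → K} {X Y : A →ₗ[K] C} (hX : IsTwisted l X Y) (hY : IsTwisted l Y X)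
    {e₁ e₂ : A} (hA : finrank K A = 2) (he : LinearIndependent K ![e₁, e₂]) {t : A}
    (ht : ∀ f g : A →ₗ[K] K, IsTwisted l f g → IsTwisted l g f → f t = 0) :
    IsNilpotent (X t) := by
  obtain ⟨L, hL₁, hL₂⟩ := exists_linearMap hA he
    (MvPolynomial.X 0 : MvPolynomial (Fin 4) K) (MvPolynomial.X 1)
  obtain ⟨M, hM₁, hM₂⟩ := exists_linearMap hA he
    (MvPolynomial.X 2 : MvPolynomial (Fin 4) K) (MvPolynomial.X 3)
  let ev : MvPolynomial (Fin 4) K →ₐ[K] C := MvPolynomial.aeval ![X e₁, X e₂, Y e₁, Y e₂]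
  have evL : ∀ u, ev (L u) = X u := fun u => by
    obtain ⟨x, y, rfl⟩ := exists_coords hA he u
    simp [hL₁, hL₂, ev]
  have evM : ∀ u, ev (M u) = Y u := fun u => by
    obtain ⟨x, y, rfl⟩ := exists_coords hA he u
    simp [hM₁, hM₂, ev]
  have key : L t ∈ MvPolynomial.vanishingIdeal K
      (MvPolynomial.zeroLocus K (RingHom.ker ev)) := by
    intro z hz
    let ez : MvPolynomial (Fin 4) K →ₐ[K] K := MvPolynomial.aeval z
    have hz' : ∀ p, ev p = 0 → ez p = 0 := fun p hp => hz p hp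
    refine ht (ez.toLinearMap ∘ₗ L) (ez.toLinearMap ∘ₗ M) (fun u v => ?_) (fun u v => ?_)
    · have := hz' (L (u * v) - (l 0 • (L u * L v) + l 1 • (L u * M v) + l 2 • (M u * L v) +
        l 3 • (M u * M v))) (by
          simp only [map_sub, map_add, map_smul, map_mul, evL, evM, hX u v, sub_self])
      simpa only [map_sub, map_add, map_smul, map_mul, sub_eq_zero, LinearMap.comp_apply,
        AlgHom.toLinearMap_apply] using this
    · have := hz' (M (u * v) - (l 0 • (M u * M v) + l 1 • (M u * L v) + l 2 • (L u * M v) +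
        l 3 • (L u * L v))) (by
          simp only [map_sub, map_add, map_smul, map_mul, evL, evM, hY u v, sub_self])
      simpa only [map_sub, map_add, map_smul, map_mul, sub_eq_zero, LinearMap.comp_apply,
        AlgHom.toLinearMap_apply] using this
  rw [MvPolynomial.vanishingIdeal_zeroLocus_eq_radical] at key
  obtain ⟨n, hn⟩ := key
  exact ⟨n, by rw [← evL, ← map_pow]; exact hn⟩

/-- Two independent scalar solutions of the representation equations are swapped by an
automorphism. -/
theorem IsTwisted.hasNontrivialAut {l : Fin 4 → K} {f g : A →ₗ[K] K}
    (hf : IsTwisted l f g) (hg : IsTwisted l g f) {e₁ e₂ : A} (hA : finrank K A = 2)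
    (he : LinearIndependent K ![e₁, e₂]) (hfg : f e₁ * g e₂ - f e₂ * g e₁ ≠ 0) :
    HasNontrivialAut K A := by
  have : FiniteDimensional K A := .of_finrank_pos (by omega)
  have hinj : Function.Injective (f.prod g) := by
    refine injective_of_coords hA he (LinearIndependent.pair_iff.2 fun s t h => ?_)
    have h1 : s * f e₁ + t * f e₂ = 0 := congr_arg Prod.fst h
    have h2 : s * g e₁ + t * g e₂ = 0 := congr_arg Prod.snd h
    refine ⟨(mul_eq_zero_iff_right hfg).1 ?_, (mul_eq_zero_iff_right hfg).1 ?_⟩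
    · linear_combination g e₂ * h1 - f e₂ * h2
    · linear_combination f e₁ * h2 - g e₁ * h1
  let T : A ≃ₗ[K] K × K := (f.prod g).linearEquivOfInjective hinj (by simp [hA])
  let θ : A ≃ₗ[K] A := T ≪≫ₗ LinearEquiv.prodComm K K K ≪≫ₗ T.symm
  have hT : ∀ u, T u = (f u, g u) := fun u => rfl
  have hθ : ∀ u, T (θ u) = (g u, f u) := fun u => T.apply_symm_apply _
  have hfθ : ∀ u, f (θ u) = g u := fun u => congr_arg Prod.fst (hθ u)
  have hgθ : ∀ u, g (θ u) = f u := fun u => congr_arg Prod.snd (hθ u)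
  refine ⟨θ, θ.bijective, fun u v => T.injective ?_, fun h => hfg ?_⟩
  · simp [hT, hfθ, hgθ, hf (θ u) (θ v), hg (θ u) (θ v), hf u v, hg u v]
  · have h' : ∀ u, θ u = u := fun u => LinearMap.congr_fun h u
    have h1 := hfθ e₁
    have h2 := hfθ e₂
    rw [h'] at h1 h2
    rw [h1, h2, mul_comm, sub_self]

theorem IsTwisted.exists_eq_mul {l : Fin 4 → K} {f g : A →ₗ[K] K}
    (hf : IsTwisted l f g) {e₁ e₂ : A} (hA : finrank K A = 2)
    (he : LinearIndependent K ![e₁, e₂]) (hfg : f e₁ * g e₂ - f e₂ * g e₁ = 0) :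
    ∃ c : K, ∀ u v, f (u * v) = c * (f u * f v) := by
  by_cases h0 : f = 0
  · exact ⟨0, by simp [h0]⟩
  obtain ⟨k, hk⟩ : ∃ k : K, ∀ u, g u = k * f u := by
    by_cases h1 : f e₁ = 0
    · have h2 : f e₂ ≠ 0 := fun h2 => h0 <| LinearMap.ext fun u => by
        obtain ⟨s, t, rfl⟩ := exists_coords hA he u
        simp [h1, h2]
      refine ⟨g e₂ / f e₂, fun u => ?_⟩
      obtain ⟨s, t, rfl⟩ := exists_coords hA he u
      have h3 : g e₁ = 0 := by simpa [h1, h2] using hfg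
      simp [h1, h3]
      field_simp
    · refine ⟨g e₁ / f e₁, fun u => ?_⟩
      obtain ⟨s, t, rfl⟩ := exists_coords hA he u
      simp only [map_add, map_smul, smul_eq_mul]
      field_simp
      linear_combination t * hfg
  refine ⟨l 0 + l 1 * k + l 2 * k + l 3 * k ^ 2, fun u v => ?_⟩
  rw [hf u v, hk, hk]
  simp only [smul_eq_mul]
  ring

variable [SMulCommClass K A A] [IsScalarTower K A A]

variable (K A) in
/-- The equivalence of faithful representability and existence of a nontrivial automorphism. -/
def RepIffAut : Prop := Nonempty (FaithfulRep K A) ↔ HasNontrivialAut K A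

theorem FaithfulRep.exists_isTwisted (R : FaithfulRep K A) :
    ∃ (C : Type) (_ : CommRing C) (_ : Algebra K C) (l : Fin 4 → K) (X Y : A →ₗ[K] C),
      Function.Injective X ∧ IsTwisted l X Y ∧ IsTwisted l Y X := by
  obtain ⟨B, l0, l1, l2, l3, s, hsmul, hsinv, σ, inj, rep⟩ := R
  let i : B →ₗ[K] Unitization K B := Unitization.inrHom K K B
  have hi : ∀ x y : B, i (x * y) = i x * i y := fun x y => Unitization.inr_mul K x y
  refine ⟨Unitization K B, inferInstance, inferInstance, ![l0, l1, l2, l3], i ∘ₗ σ,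
    i ∘ₗ s ∘ₗ σ, Unitization.inr_injective.comp inj, fun u v => ?_, fun u v => ?_⟩
  · simp [rep, hi]
  · simp [rep, hi, hsmul, hsinv]

/-- If `A` contains a nonzero finite set that is spanned by its own products and annihilated by all
functionals that are multiplicative up to a scalar, then a faithful representation of `A` forces a
nontrivial automorphism. -/
theorem FaithfulRep.hasNontrivialAut [IsAlgClosed K] (R : FaithfulRep K A) {e₁ e₂ : A}
    (hA : finrank K A = 2) (he : LinearIndependent K ![e₁, e₂]) {S : Set A} (hS : S.Finite)
    (hprod : ∀ t ∈ S, t ∈ Submodule.span K {x | ∃ u ∈ S, ∃ v ∈ S, x = u * v})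
    (hne : ∃ t ∈ S, t ≠ 0)
    (hvan : ∀ (f : A →ₗ[K] K) (c : K), (∀ u v, f (u * v) = c * (f u * f v)) →
      ∀ t ∈ S, f t = 0) :
    HasNontrivialAut K A := by
  by_contra hcon
  obtain ⟨C, _, _, l, X, Y, hinj, hX, hY⟩ := R.exists_isTwisted
  have hpt : ∀ t ∈ S, ∀ f g : A →ₗ[K] K, IsTwisted l f g → IsTwisted l g f → f t = 0 := by
    intro t ht f g hf hg
    obtain ⟨c, hc⟩ := hf.exists_eq_mul hA he
      (by_contra fun h => hcon (hf.hasNontrivialAut hg hA he h))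
    exact hvan f c hc t ht
  obtain ⟨t, ht, ht0⟩ := hne
  refine ht0 (hinj ?_)
  rw [map_zero]
  exact hX.eq_zero_of_isNilpotent hY hS hprod (fun t ht => hX.isNilpotent hY hA he (hpt t ht))
    (fun t ht => hY.isNilpotent hX hA he (hpt t ht)) t ht

/-- A commutative associative algebra represents itself. -/
theorem nonempty_faithfulRep_of_assoc (hassoc : ∀ u v w : A, u * v * w = u * (v * w))
    (hcomm : ∀ u v : A, u * v = v * u) : Nonempty (FaithfulRep K A) :=
  ⟨{ B := A
     ringB := { (inferInstance : NonUnitalNonAssocRing A) with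
       mul_assoc := hassoc
       mul_comm := hcomm }
     modB := inferInstance
     smulB := ‹_›
     towerB := ‹_›
     l0 := 1
     l1 := 0
     l2 := 0
     l3 := 0
     s := LinearMap.id
     hsmul := fun _ _ => rfl
     hsinv := fun _ => rfl
     σ := LinearMap.id
     inj := Function.injective_id
     rep := fun u v => by simp }⟩

/-- An algebra with an involutive automorphism that is not diagonal is represented in `K × K` with
the exchange involution. -/
theorem nonempty_faithfulRep_of_involution (hA : finrank K A = 2) {θ : A →ₗ[K] A}
    (hmul : ∀ u v, θ (u * v) = θ u * θ v) (hinv : ∀ u, θ (θ u) = u) {v : A}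
    (hv : LinearIndependent K ![v, θ v]) : Nonempty (FaithfulRep K A) := by
  obtain ⟨φ, h1, h2⟩ := exists_linearMap hA hv (1 : K) 0
  exact ⟨{
    B := K × K
    l0 := φ (v * v)
    l1 := φ (v * θ v)
    l2 := φ (θ v * v)
    l3 := φ (θ v * θ v)
    s := (LinearEquiv.prodComm K K K).toLinearMap
    hsmul := fun _ _ => rfl
    hsinv := fun _ => rfl
    σ := φ.prod (φ ∘ₗ θ)
    inj := injective_of_coords hA hv (LinearIndependent.pair_iff.2 (by simp [h1, h2, hinv]))
    rep := fun x y => by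
      obtain ⟨s, t, rfl⟩ := exists_coords hA hv x
      obtain ⟨s', t', rfl⟩ := exists_coords hA hv y
      ext
      · simp [h1, h2, hinv, add_mul, mul_add, smul_mul_assoc, mul_smul_comm]
        ring
      · simp [h1, h2, hinv, hmul, add_mul, mul_add, smul_mul_assoc, mul_smul_comm]
        ring }⟩

end General

section Evolution

/-- The vectors `e₁`, `e₂` form a natural basis of the evolution algebra `A` whose structure matrix
has rows `(a, b)` and `(c, d)`. -/
structure IsNaturalBasis {K : Type} [Field K] {A : Type} [NonUnitalNonAssocRing A] [Module K A]
    (e₁ e₂ : A) (a b c d : K) : Prop where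
  finrank_eq : finrank K A = 2
  linearIndependent : LinearIndependent K ![e₁, e₂]
  mul₁₂ : e₁ * e₂ = 0
  mul₂₁ : e₂ * e₁ = 0
  mul₁₁ : e₁ * e₁ = a • e₁ + b • e₂
  mul₂₂ : e₂ * e₂ = c • e₁ + d • e₂

/-- The equations expressing that `e₁ ↦ p e₁ + q e₂`, `e₂ ↦ r e₁ + s e₂` is multiplicative. -/
def IsMulMatrix {K : Type} [Field K] (a b c d p q r s : K) : Prop :=
  (p * r * a + q * s * c = 0 ∧ p * r * b + q * s * d = 0) ∧
  (a * p + b * r = p ^ 2 * a + q ^ 2 * c ∧ a * q + b * s = p ^ 2 * b + q ^ 2 * d) ∧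
  (c * p + d * r = r ^ 2 * a + s ^ 2 * c ∧ c * q + d * s = r ^ 2 * b + s ^ 2 * d)

/-- An automorphism of an evolution algebra with nonsingular structure matrix permutes the lines
spanned by the natural basis. -/
theorem IsMulMatrix.mul_eq_zero {K : Type} [Field K] {a b c d p q r s : K} (h : IsMulMatrix a b c d p q r s)
    (hdet : a * d - b * c ≠ 0) : p * r = 0 ∧ q * s = 0 := by
  obtain ⟨⟨a1, a2⟩, -⟩ := h
  constructor <;> refine (mul_eq_zero_iff_right hdet).1 ?_
  · linear_combination d * a1 - c * a2
  · linear_combination a * a2 - b * a1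

theorem IsMulMatrix.monomial {K : Type} [Field K] {a b c d p q r s : K} (h : IsMulMatrix a b c d p q r s)
    (hdet : a * d - b * c ≠ 0) (h' : p * s - q * r ≠ 0) :
    (q = 0 ∧ r = 0 ∧ p ≠ 0 ∧ s ≠ 0) ∨ (p = 0 ∧ s = 0 ∧ q ≠ 0 ∧ r ≠ 0) := by
  obtain ⟨h1, h2⟩ := h.mul_eq_zero hdet
  rcases _root_.mul_eq_zero.1 h1 with rfl | rfl <;> rcases _root_.mul_eq_zero.1 h2 with rfl | rfl <;>
    simp_all

namespace IsNaturalBasis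

variable {K : Type} [Field K] {A : Type} [NonUnitalNonAssocRing A] [Module K A]
  {e₁ e₂ : A} {a b c d : K}

theorem symm (E : IsNaturalBasis e₁ e₂ a b c d) : IsNaturalBasis e₂ e₁ d c b a where
  finrank_eq := E.finrank_eq
  linearIndependent := LinearIndependent.pair_symm_iff.1 E.linearIndependent
  mul₁₂ := E.mul₂₁
  mul₂₁ := E.mul₁₂
  mul₁₁ := by rw [E.mul₂₂, add_comm]
  mul₂₂ := by rw [E.mul₁₁, add_comm]

theorem coords_inj (E : IsNaturalBasis e₁ e₂ a b c d) {s t s' t' : K}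
    (h : s • e₁ + t • e₂ = s' • e₁ + t' • e₂) : s = s' ∧ t = t' := by
  have := LinearIndependent.pair_iff.1 E.linearIndependent (s - s') (t - t')
    (by rw [sub_smul, sub_smul, sub_add_sub_comm, h, sub_self])
  simpa [sub_eq_zero] using this

theorem functional_eqs (E : IsNaturalBasis e₁ e₂ a b c d) {f : A →ₗ[K] K} {k : K}
    (hf : ∀ u v, f (u * v) = k * (f u * f v)) :
    k * (f e₁ * f e₂) = 0 ∧ a * f e₁ + b * f e₂ = k * (f e₁ * f e₁) ∧
      c * f e₁ + d * f e₂ = k * (f e₂ * f e₂) := by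
  refine ⟨?_, ?_, ?_⟩ <;> rw [← hf]
  · simp [E.mul₁₂]
  · simp [E.mul₁₁]
  · simp [E.mul₂₂]

variable [SMulCommClass K A A] [IsScalarTower K A A]

theorem smul (E : IsNaturalBasis e₁ e₂ a b c d) {s t : K} (hs : s ≠ 0) (ht : t ≠ 0) :
    IsNaturalBasis (s • e₁) (t • e₂) (s * a) (s ^ 2 * b / t) (t ^ 2 * c / s) (t * d) where
  finrank_eq := E.finrank_eq
  linearIndependent := LinearIndependent.pair_iff.2 fun x y h => by
    rw [smul_smul, smul_smul] at h
    simpa [hs, ht] using LinearIndependent.pair_iff.1 E.linearIndependent _ _ h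
  mul₁₂ := by simp [smul_mul_assoc, mul_smul_comm, E.mul₁₂]
  mul₂₁ := by simp [smul_mul_assoc, mul_smul_comm, E.mul₂₁]
  mul₁₁ := by
    simp only [smul_mul_assoc, mul_smul_comm, E.mul₁₁, smul_add, smul_smul]
    congr 2
    · ring
    · field_simp
  mul₂₂ := by
    simp only [smul_mul_assoc, mul_smul_comm, E.mul₂₂, smul_add, smul_smul]
    congr 2
    · field_simp
    · ring

theorem mul_eq (E : IsNaturalBasis e₁ e₂ a b c d) (s t s' t' : K) :
    (s • e₁ + t • e₂) * (s' • e₁ + t' • e₂) =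
      (s * s' * a + t * t' * c) • e₁ + (s * s' * b + t * t' * d) • e₂ := by
  simp only [add_mul, mul_add, smul_mul_assoc, mul_smul_comm, E.mul₁₁, E.mul₁₂, E.mul₂₁, E.mul₂₂]
  module

theorem exists_mulHom (E : IsNaturalBasis e₁ e₂ a b c d) {p q r s : K}
    (h : IsMulMatrix a b c d p q r s) :
    ∃ θ : A →ₗ[K] A, (∀ x y : K, θ (x • e₁ + y • e₂) =
      (x * p + y * r) • e₁ + (x * q + y * s) • e₂) ∧ ∀ u v, θ (u * v) = θ u * θ v := by
  obtain ⟨θ, h1, h2⟩ := exists_linearMap E.finrank_eq E.linearIndependent (p • e₁ + q • e₂)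
    (r • e₁ + s • e₂)
  have hθ : ∀ x y : K, θ (x • e₁ + y • e₂) =
      (x * p + y * r) • e₁ + (x * q + y * s) • e₂ := fun x y => by
    simp only [map_add, map_smul, h1, h2]
    module
  refine ⟨θ, hθ, fun u v => ?_⟩
  obtain ⟨x, y, rfl⟩ := exists_coords E.finrank_eq E.linearIndependent u
  obtain ⟨x', y', rfl⟩ := exists_coords E.finrank_eq E.linearIndependent v
  obtain ⟨⟨a1, a2⟩, ⟨a3, a4⟩, a5, a6⟩ := h
  rw [E.mul_eq, hθ, hθ, hθ, E.mul_eq]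
  congr 2
  · linear_combination x * x' * a3 + y * y' * a5 - (x * y' + x' * y) * a1
  · linear_combination x * x' * a4 + y * y' * a6 - (x * y' + x' * y) * a2

theorem hasNontrivialAut (E : IsNaturalBasis e₁ e₂ a b c d) {p q r s : K}
    (h : IsMulMatrix a b c d p q r s) (hdet : p * s - q * r ≠ 0)
    (hne : ¬ (p = 1 ∧ q = 0 ∧ r = 0 ∧ s = 1)) : HasNontrivialAut K A := by
  have : FiniteDimensional K A := .of_finrank_pos (by rw [E.finrank_eq]; omega)
  obtain ⟨θ, hθ, hmul⟩ := E.exists_mulHom h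
  have h1 : θ e₁ = p • e₁ + q • e₂ := by simpa using hθ 1 0
  have h2 : θ e₂ = r • e₁ + s • e₂ := by simpa using hθ 0 1
  have hinj : Function.Injective θ := by
    refine injective_of_coords E.finrank_eq E.linearIndependent ?_
    rw [h1, h2]
    exact (LinearIndependent.pair_add_smul_add_smul_iff ..).2
      ⟨E.linearIndependent, sub_ne_zero.1 hdet⟩
  refine ⟨θ, ⟨hinj, LinearMap.injective_iff_surjective.1 hinj⟩, hmul, fun hid => hne ?_⟩
  rw [hid] at h1 h2
  obtain ⟨hp, hq⟩ := E.coords_inj (s := 1) (t := 0) (by simpa using h1)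
  obtain ⟨hr, hs⟩ := E.coords_inj (s := 0) (t := 1) (by simpa using h2)
  exact ⟨hp.symm, hq.symm, hr.symm, hs.symm⟩

theorem not_hasNontrivialAut (E : IsNaturalBasis e₁ e₂ a b c d)
    (h : ∀ p q r s : K, IsMulMatrix a b c d p q r s → p * s - q * r ≠ 0 →
      p = 1 ∧ q = 0 ∧ r = 0 ∧ s = 1) : ¬ HasNontrivialAut K A := by
  rintro ⟨θ, hbij, hmul, hid⟩
  obtain ⟨p, q, h1⟩ := exists_coords E.finrank_eq E.linearIndependent (θ e₁)
  obtain ⟨r, s, h2⟩ := exists_coords E.finrank_eq E.linearIndependent (θ e₂)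
  have hθ : ∀ x y : K, θ (x • e₁ + y • e₂) =
      (x * p + y * r) • e₁ + (x * q + y * s) • e₂ := fun x y => by
    simp only [map_add, map_smul, h1, h2]
    module
  have hdet : p * s - q * r ≠ 0 := fun h0 => by
    have ker : ∀ x y : K, x * p + y * r = 0 → x * q + y * s = 0 → x = 0 ∧ y = 0 := by
      intro x y hx hy
      refine LinearIndependent.pair_iff.1 E.linearIndependent x y (hbij.1 ?_)
      rw [hθ, hx, hy]
      simp
    obtain ⟨hs, hq⟩ := ker s (-q) (by linear_combination h0) (by ring)
    obtain ⟨hr, hp⟩ := ker r (-p) (by ring) (by linear_combination -h0)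
    rw [neg_eq_zero] at hq hp
    exact one_ne_zero (ker 1 0 (by simp [hp]) (by simp [hq])).1
  have h12 := hmul e₁ e₂
  have h11 := hmul e₁ e₁
  have h22 := hmul e₂ e₂
  rw [E.mul₁₂, map_zero, h1, h2, E.mul_eq] at h12
  rw [E.mul₁₁, hθ, h1, E.mul_eq] at h11
  rw [E.mul₂₂, hθ, h2, E.mul_eq] at h22
  have h12' := LinearIndependent.pair_iff.1 E.linearIndependent _ _ h12.symm
  have h11' := E.coords_inj h11
  have h22' := E.coords_inj h22
  simp only [← pow_two] at h11' h22'
  obtain ⟨rfl, rfl, rfl, rfl⟩ := h p q r s ⟨h12', h11', h22'⟩ hdet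
  refine hid (LinearMap.ext fun u => ?_)
  obtain ⟨x, y, rfl⟩ := exists_coords E.finrank_eq E.linearIndependent u
  simp [h1, h2]

/-- Both sides of the equivalence hold when an involution `θ` of the natural basis is given together
with a vector `x e₁ + y e₂` that is not an eigenvector of `θ`. -/
theorem repIffAut_of_involution (E : IsNaturalBasis e₁ e₂ a b c d) {p q r s : K}
    (h : IsMulMatrix a b c d p q r s) (hp : p ^ 2 + q * r = 1) (hq : q * (p + s) = 0)
    (hr : r * (p + s) = 0) (hs : s ^ 2 + q * r = 1) {x y : K}
    (hxy : x * (x * q + y * s) - y * (x * p + y * r) ≠ 0) : RepIffAut K A := by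
  obtain ⟨θ, hθ, hmul⟩ := E.exists_mulHom h
  have hinv : ∀ u, θ (θ u) = u := fun u => by
    obtain ⟨z, w, rfl⟩ := exists_coords E.finrank_eq E.linearIndependent u
    rw [hθ, hθ]
    congr 2
    · linear_combination z * hp + w * hr
    · linear_combination z * hq + w * hs
  have hv : LinearIndependent K ![x • e₁ + y • e₂, θ (x • e₁ + y • e₂)] := by
    rw [hθ]
    exact (LinearIndependent.pair_add_smul_add_smul_iff ..).2
      ⟨E.linearIndependent, sub_ne_zero.1 hxy⟩
  refine iff_of_true (nonempty_faithfulRep_of_involution E.finrank_eq hmul hinv hv)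
    ⟨θ, Function.Involutive.bijective hinv, hmul, ?_⟩
  rintro rfl
  simpa using LinearIndependent.pair_iff.1 hv 1 (-1) (by rw [LinearMap.id_apply]; module)

theorem repIffAut_of_perfect [IsAlgClosed K] (E : IsNaturalBasis e₁ e₂ a b c d)
    (hdet : a * d - b * c ≠ 0)
    (hvan : ∀ k x y : K, k * (x * y) = 0 → a * x + b * y = k * (x * x) →
      c * x + d * y = k * (y * y) → x = 0 ∧ y = 0)
    (haut : ¬ HasNontrivialAut K A) : RepIffAut K A := by
  refine iff_of_false (fun ⟨R⟩ => haut ?_) haut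
  have hmem : ∀ x y : K, x • (e₁ * e₁) + y • (e₂ * e₂) ∈
      Submodule.span K {z | ∃ u ∈ ({e₁, e₂} : Set A), ∃ v ∈ ({e₁, e₂} : Set A), z = u * v} :=
    fun x y => add_mem
      (Submodule.smul_mem _ _ (Submodule.subset_span ⟨e₁, by simp, e₁, by simp, rfl⟩))
      (Submodule.smul_mem _ _ (Submodule.subset_span ⟨e₂, by simp, e₂, by simp, rfl⟩))
  refine R.hasNontrivialAut E.finrank_eq E.linearIndependent (S := {e₁, e₂}) (by simp) ?_
    ⟨e₁, by simp, E.linearIndependent.ne_zero 0⟩ fun f k hf => ?_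
  · rintro t (rfl | rfl)
    · convert Submodule.smul_mem _ (a * d - b * c)⁻¹ (hmem d (-b)) using 1
      rw [eq_inv_smul_iff₀ hdet, E.mul₁₁, E.mul₂₂]
      module
    · convert Submodule.smul_mem _ (a * d - b * c)⁻¹ (hmem (-c) a) using 1
      rw [eq_inv_smul_iff₀ hdet, E.mul₁₁, E.mul₂₂]
      module
  · obtain ⟨h1, h2, h3⟩ := E.functional_eqs hf
    obtain ⟨hx, hy⟩ := hvan k _ _ h1 h2 h3
    rintro t (rfl | rfl)
    exacts [hx, hy]

theorem repIffAut_of_idempotent [IsAlgClosed K] (E : IsNaturalBasis e₁ e₂ a b c d) {w : A}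
    (hw : w ≠ 0) {m : K} (hm : m ≠ 0) (hww : w * w = m • w)
    (hvan : ∀ (f : A →ₗ[K] K) (k : K), (∀ u v, f (u * v) = k * (f u * f v)) → f w = 0)
    (haut : ¬ HasNontrivialAut K A) : RepIffAut K A := by
  refine iff_of_false (fun ⟨R⟩ => haut ?_) haut
  refine R.hasNontrivialAut E.finrank_eq E.linearIndependent (S := {w}) (by simp) ?_
    ⟨w, rfl, hw⟩ ?_
  · rintro t (rfl : t = w)
    have := Submodule.smul_mem (Submodule.span K {x | ∃ u ∈ ({t} : Set A), ∃ v ∈ ({t} : Set A),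
      x = u * v}) m⁻¹ (Submodule.subset_span ⟨t, rfl, t, rfl, rfl⟩)
    rwa [hww, inv_smul_smul₀ hm] at this
  · rintro f k hf _ rfl
    exact hvan f k hf

theorem repIffAut_of_sq_eq_zero [IsAlgClosed K] (E : IsNaturalBasis e₁ e₂ a b 0 0) :
    RepIffAut K A := by
  refine iff_of_true (nonempty_faithfulRep_of_assoc (fun u v w => ?_) fun u v => ?_) ?_
  · obtain ⟨x, y, rfl⟩ := exists_coords E.finrank_eq E.linearIndependent u
    obtain ⟨x', y', rfl⟩ := exists_coords E.finrank_eq E.linearIndependent v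
    obtain ⟨x'', y'', rfl⟩ := exists_coords E.finrank_eq E.linearIndependent w
    simp only [E.mul_eq]
    congr 2 <;> ring
  · obtain ⟨x, y, rfl⟩ := exists_coords E.finrank_eq E.linearIndependent u
    obtain ⟨x', y', rfl⟩ := exists_coords E.finrank_eq E.linearIndependent v
    simp only [E.mul_eq]
    congr 2 <;> ring
  · by_cases ha : a = 0
    · subst ha
      exact E.hasNontrivialAut (p := 1) (q := 1) (r := 0) (s := 1) (by simp [IsMulMatrix])
        (by simp) (by simp)
    · obtain ⟨t, ht⟩ := (Set.toFinite ({0, 1} : Set K)).exists_notMem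
      simp only [Set.mem_insert_iff, Set.mem_singleton_iff, not_or] at ht
      refine E.hasNontrivialAut (p := 1) (q := b / a * (1 - t)) (r := 0) (s := t) ?_ ?_ ?_
      · simp only [IsMulMatrix]
        refine ⟨⟨by ring, by ring⟩, ⟨by ring, ?_⟩, by ring, by ring⟩
        field_simp
        ring
      · simpa using ht.1
      · simp [ht.2]

theorem repIffAut_of_sq_eq_sq [IsAlgClosed K] (E : IsNaturalBasis e₁ e₂ a b a b)
    (hab : ¬ (a = 0 ∧ b = 0)) : RepIffAut K A := by
  by_cases hN : a ^ 2 + b ^ 2 = 0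
  · have ha : a ≠ 0 := by
      rintro rfl
      simp_all
    have hb : b ≠ 0 := by
      rintro rfl
      simp_all
    have hi : (b / a) ^ 2 = -1 := by
      field_simp
      linear_combination hN
    have hb' : b = b / a * a := by field_simp
    generalize b / a = i at hi hb'
    subst hb'
    refine E.repIffAut_of_involution (p := 0) (q := -i) (r := i) (s := 0) (x := 1) (y := 0)
      ?_ ?_ ?_ ?_ ?_ ?_
    · refine ⟨⟨?_, ?_⟩, ⟨?_, ?_⟩, ?_, ?_⟩
      · ring
      · ring
      · ring
      · linear_combination -i * a * hi
      · ring
      · linear_combination -i * a * hi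
    · linear_combination -hi
    · ring
    · ring
    · linear_combination -hi
    · rintro h
      have : i = 0 := by linear_combination -h
      simp [this] at hb
  by_cases h2 : (2 : K) = 0
  · have hsum : a + b ≠ 0 := fun h => hN (by linear_combination (a + b) * h - a * b * h2)
    refine E.repIffAut_of_idempotent (w := a • e₁ + b • e₂) (m := a ^ 2 + b ^ 2) ?_ hN ?_ ?_
      (E.not_hasNontrivialAut ?_)
    · exact fun h => hab (LinearIndependent.pair_iff.1 E.linearIndependent _ _ h)
    · rw [E.mul_eq]
      module
    · intro f k hf
      obtain ⟨h1, h2, h3⟩ := E.functional_eqs hf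
      simp only [map_add, map_smul, smul_eq_mul]
      rcases mul_eq_zero.1 h1 with h | h
      · rw [h2, h, zero_mul]
      · rcases mul_eq_zero.1 h with h | h
        · rw [h2, h, zero_mul, mul_zero]
        · rw [h3, h, zero_mul, mul_zero]
    · rintro p q r s ⟨⟨a1, a2⟩, ⟨a3, a4⟩, a5, a6⟩ hdet
      have h0 : p * r + q * s = 0 := by
        refine (mul_eq_zero_iff_right hsum).1 ?_
        linear_combination a1 + a2
      have hm : (p + q + (r + s)) ^ 2 = 0 := by
        refine (mul_eq_zero_iff_right hsum).1 ?_
        linear_combination a5 + a6 - a3 - a4 + (a + b) * (p * q + r * s + p * r + p * s + q * r +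
          q * s + r ^ 2 + s ^ 2) * h2
      have hm' : p + q + (r + s) = 0 := pow_eq_zero_iff two_ne_zero |>.1 hm
      have hmm : (p + q) * (p + q - 1) = 0 := by
        refine (mul_eq_zero_iff_right hsum).1 ?_
        linear_combination -a3 - a4 + b * hm' + (a + b) * p * q * h2 - b * (p + q) * h2
      rcases mul_eq_zero.1 hmm with h | h
      · refine absurd ?_ hdet
        linear_combination (p * hm' - (p + r) * h)
      · have hq : q = 1 - p := by linear_combination h
        have hs : s = 1 - r := by linear_combination hm' - h - h2
        subst hq hs
        have hr : r = 1 - p := by linear_combination -h0 + p * r * h2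
        subst hr
        have hp : p - 1 = 0 := by
          refine (mul_eq_zero_iff_right hsum).1 ?_
          linear_combination a3 + (a * (p ^ 2 - p) + b * (p - 1)) * h2
        have hp' : p = 1 := by linear_combination hp
        simp [hp']
  · have key : ∀ x y : K, x * (x * (2 * a * b / (a ^ 2 + b ^ 2)) +
        y * ((b ^ 2 - a ^ 2) / (a ^ 2 + b ^ 2))) - y * (x * ((a ^ 2 - b ^ 2) / (a ^ 2 + b ^ 2)) +
        y * (2 * a * b / (a ^ 2 + b ^ 2))) ≠ 0 → RepIffAut K A := by
      intro x y hxy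
      refine E.repIffAut_of_involution ?_ ?_ ?_ ?_ ?_ hxy
      · refine ⟨⟨?_, ?_⟩, ⟨?_, ?_⟩, ?_, ?_⟩ <;> field_simp <;> ring
      all_goals field_simp; ring
    by_cases h0 : a * b = 0
    · refine key 1 1 fun h => ?_
      have h' : 2 * (a ^ 2 - b ^ 2) = 0 := by
        field_simp at h
        linear_combination -h
      rcases mul_eq_zero.1 h0 with rfl | rfl <;> simp_all
    · refine key 1 0 fun h => ?_
      field_simp at h
      simp_all

theorem repIffAut_of_diag_eq_zero [IsAlgClosed K] (E : IsNaturalBasis e₁ e₂ 0 b c 0)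
    (hb : b ≠ 0) (hc : c ≠ 0) : RepIffAut K A := by
  obtain ⟨s, hs⟩ := IsAlgClosed.exists_pow_nat_eq (b / c) (n := 3) (by norm_num)
  have hs0 : s ≠ 0 := by
    rintro rfl
    simp [eq_comm, hb, hc] at hs
  have hbs : b = s ^ 3 * c := by
    rw [hs]
    field_simp
  subst hbs
  refine E.repIffAut_of_involution (p := 0) (q := s) (r := s⁻¹) (s := 0) (x := 1) (y := 0)
    ?_ ?_ ?_ ?_ ?_ ?_
  · refine ⟨⟨?_, ?_⟩, ⟨?_, ?_⟩, ?_, ?_⟩ <;> field_simp <;> ring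
  all_goals simp [hs0]

theorem repIffAut_of_one_diag [IsAlgClosed K] (E : IsNaturalBasis e₁ e₂ 0 b c 1)
    (hb : b ≠ 0) (hc : c ≠ 0) : RepIffAut K A := by
  have hdet : 0 * 1 - b * c ≠ 0 := by simp [hb, hc]
  refine E.repIffAut_of_perfect hdet (fun k x y h1 h2 h3 => ?_)
    (E.not_hasNontrivialAut fun p q r s h h' => ?_)
  · rcases mul_eq_zero.1 h1 with rfl | h
    · simp_all
    · rcases mul_eq_zero.1 h with rfl | rfl <;> simp_all
  · rcases h.monomial hdet h' with ⟨rfl, rfl, hp, hs⟩ | ⟨rfl, rfl, hq, hr⟩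
    · obtain ⟨-, -, h5, h6⟩ := h
      have hs1 : s = 1 := mul_right_cancel₀ hs (by linear_combination -h6)
      subst hs1
      exact ⟨mul_left_cancel₀ hc (by linear_combination h5), rfl, rfl, rfl⟩
    · obtain ⟨-, ⟨-, h4⟩, -⟩ := h
      exact absurd (by linear_combination -h4) (pow_ne_zero 2 hq)

theorem repIffAut_of_diag_eq_one [IsAlgClosed K] (E : IsNaturalBasis e₁ e₂ 1 b c 1)
    (hdet : 1 * 1 - b * c ≠ 0) : RepIffAut K A := by
  by_cases hbc : b = c
  · subst hbc
    exact E.repIffAut_of_involution (p := 0) (q := 1) (r := 1) (s := 0) (x := 1) (y := 0)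
      (by simp [IsMulMatrix]) (by simp) (by simp) (by simp) (by simp) (by simp)
  have haut : ¬ HasNontrivialAut K A := by
    refine E.not_hasNontrivialAut fun p q r s h h' => ?_
    rcases h.monomial hdet h' with ⟨rfl, rfl, hp, hs⟩ | ⟨rfl, rfl, hq, hr⟩
    · obtain ⟨-, ⟨h3, -⟩, -, h6⟩ := h
      exact ⟨mul_right_cancel₀ hp (by linear_combination -h3), rfl, rfl,
        mul_right_cancel₀ hs (by linear_combination -h6)⟩
    · obtain ⟨-, ⟨h3, h4⟩, h5, h6⟩ := h
      have hq1 : q = 1 := mul_right_cancel₀ hq (by linear_combination -h4)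
      have hr1 : r = 1 := mul_right_cancel₀ hr (by linear_combination -h5)
      subst hq1 hr1
      exact absurd (by linear_combination h3) hbc
  by_cases hc : c = 0
  · subst hc
    have hb : b ≠ 0 := hbc
    refine E.repIffAut_of_idempotent (E.linearIndependent.ne_zero 1) one_ne_zero
      (by simp [E.mul₂₂]) (fun f k hf => ?_) haut
    obtain ⟨h1, h2, h3⟩ := E.functional_eqs hf
    change f e₂ = 0
    rcases mul_eq_zero.1 h1 with rfl | h
    · simpa using h3
    · rcases mul_eq_zero.1 h with h | h
      · simpa [h, hb] using h2
      · exact h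
  by_cases hb : b = 0
  · subst hb
    refine E.repIffAut_of_idempotent (E.linearIndependent.ne_zero 0) one_ne_zero
      (by simp [E.mul₁₁]) (fun f k hf => ?_) haut
    obtain ⟨h1, h2, h3⟩ := E.functional_eqs hf
    change f e₁ = 0
    rcases mul_eq_zero.1 h1 with rfl | h
    · simpa using h2
    · rcases mul_eq_zero.1 h with h | h
      · exact h
      · simpa [h, hc] using h3
  refine E.repIffAut_of_perfect hdet (fun k x y h1 h2 h3 => ?_) haut
  rcases mul_eq_zero.1 h1 with rfl | h
  · constructor <;> refine (mul_eq_zero_iff_right hdet).1 ?_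
    · linear_combination h2 - b * h3
    · linear_combination h3 - c * h2
  · rcases mul_eq_zero.1 h with rfl | rfl
    · exact ⟨rfl, by simpa [hb] using h2⟩
    · exact ⟨by simpa [hc] using h3, rfl⟩

theorem repIffAut [IsAlgClosed K] (E : IsNaturalBasis e₁ e₂ a b c d) : RepIffAut K A := by
  by_cases hcd : c = 0 ∧ d = 0
  · obtain ⟨rfl, rfl⟩ := hcd
    exact E.repIffAut_of_sq_eq_zero
  by_cases hab : a = 0 ∧ b = 0
  · obtain ⟨rfl, rfl⟩ := hab
    exact E.symm.repIffAut_of_sq_eq_zero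
  by_cases hdet : a * d - b * c = 0
  · obtain ⟨k, hk, rfl, rfl⟩ : ∃ k : K, k ≠ 0 ∧ c = k * a ∧ d = k * b := by
      by_cases ha : a = 0
      · have hb : b ≠ 0 := fun hb => hab ⟨ha, hb⟩
        have hc : c = 0 := by simpa [ha, hb] using hdet
        exact ⟨d / b, div_ne_zero (fun hd => hcd ⟨hc, hd⟩) hb, by simp [ha, hc], by field_simp⟩
      · have hd : d = c / a * b := by
          field_simp
          linear_combination hdet
        refine ⟨c / a, div_ne_zero (fun hc => hcd ⟨hc, ?_⟩) ha, by field_simp, hd⟩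
        rw [hd, hc, zero_div, zero_mul]
    obtain ⟨z, hz⟩ := IsAlgClosed.exists_pow_nat_eq k (n := 2) (by norm_num)
    have hz0 : z ≠ 0 := by
      rintro rfl
      simp [eq_comm, hk] at hz
    subst hz
    have E' := E.smul one_ne_zero (inv_ne_zero hz0)
    have h1 : (1 : K) ^ 2 * b / z⁻¹ = z * b := by field_simp
    have h2 : z⁻¹ ^ 2 * (z ^ 2 * a) / 1 = a := by field_simp
    have h3 : z⁻¹ * (z ^ 2 * b) = z * b := by field_simp
    rw [one_mul, h1, h2, h3] at E'
    exact E'.repIffAut_of_sq_eq_sq (by simpa [hz0] using hab)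
  by_cases ha : a = 0
  · subst ha
    have hb : b ≠ 0 := by
      rintro rfl
      simp at hdet
    have hc : c ≠ 0 := by
      rintro rfl
      simp at hdet
    by_cases hd : d = 0
    · subst hd
      exact E.repIffAut_of_diag_eq_zero hb hc
    · have E' := E.smul one_ne_zero (inv_ne_zero hd)
      rw [mul_zero, inv_mul_cancel₀ hd] at E'
      exact E'.repIffAut_of_one_diag (by simp [hb, hd]) (by simp [hc, hd])
  by_cases hd : d = 0
  · subst hd
    have hb : b ≠ 0 := by
      rintro rfl
      simp at hdet
    have hc : c ≠ 0 := by
      rintro rfl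
      simp at hdet
    have E' := E.symm.smul one_ne_zero (inv_ne_zero ha)
    rw [mul_zero, inv_mul_cancel₀ ha] at E'
    exact E'.repIffAut_of_one_diag (by simp [hc, ha]) (by simp [hb, ha])
  have E' := E.smul (inv_ne_zero ha) (inv_ne_zero hd)
  rw [inv_mul_cancel₀ ha, inv_mul_cancel₀ hd] at E'
  refine E'.repIffAut_of_diag_eq_one fun h => hdet ?_
  field_simp at h
  linear_combination h

end IsNaturalBasis

end Evolution

/-- Let `K` be an algebraically closed field and `A` a two-dimensional
evolution algebra over `K` (with natural basis `e₁, e₂`, `e₁e₂ = e₂e₁ = 0`).  Then `A`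
has a faithful associative and commutative representation if and only if `A` has a
`K`-algebra automorphism different from the identity. -/
theorem stmt16 (K : Type) [Field K] [IsAlgClosed K]
    (A : Type) [NonUnitalNonAssocRing A] [Module K A]
    [SMulCommClass K A A] [IsScalarTower K A A]
    (e₁ e₂ : A) (hind : LinearIndependent K ![e₁, e₂])
    (hspan : Submodule.span K ({e₁, e₂} : Set A) = ⊤)
    (h12 : e₁ * e₂ = 0) (h21 : e₂ * e₁ = 0) :
    Nonempty (FaithfulRep K A) ↔
    ∃ f : A →ₗ[K] A, Function.Bijective f ∧ (∀ u v : A, f (u * v) = f u * f v) ∧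
      f ≠ LinearMap.id := by
  have hA : finrank K A = 2 := by
    have := finrank_span_eq_card hind
    rw [show Set.range ![e₁, e₂] = {e₁, e₂} by simp [Set.pair_comm],
      hspan, finrank_top] at this
    simpa using this
  obtain ⟨a, b, h11⟩ := exists_coords hA hind (e₁ * e₁)
  obtain ⟨c, d, h22⟩ := exists_coords hA hind (e₂ * e₂)
  exact IsNaturalBasis.repIffAut ⟨hA, hind, h12, h21, h11, h22⟩
end
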